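/- arXiv:1303.3449 — 2 statements merged into one kernel-verified Lean document; each statement's English description precedes it below -/
import Mathlib

section
/- Let q be a prime power, n > 1 and 1 ≤ d < n be integers with n < q^{d/2} + 1, and let α ∈ 𝔽_{q^n} have degree n over 𝔽_q. Then the subgroup H of 𝔽_{q^n}^× generated by E_d = {g(α) : g ∈ P_d} equals all of 𝔽_{q^n}^×; equivalently, the Cayley graph G_d(n,q,α) is connected. -/
open Polynomial

/-- A polynomial is primary if it is a positive power of a monic irreducible polynomial. -/
def IsPrimaryPoly {F : Type*} [Field F] (g : Polynomial F) : Prop :=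
  ∃ p : Polynomial F, p.Monic ∧ Irreducible p ∧ ∃ e : ℕ, 0 < e ∧ g = p ^ e

/-- `primarySet F d` is the set `P_d` of monic primary polynomials of degree `d` over `F`. -/
def primarySet (F : Type*) [Field F] (d : ℕ) : Set (Polynomial F) :=
  {g | g.Monic ∧ g.natDegree = d ∧ IsPrimaryPoly g}

open Polynomial

lemma st_hd_pow {K : Type*} [Field K] (h : K[X]) (D : ℕ) (hD : h.natDegree ≤ D) :
    ∀ N s : ℕ, ∃ w : K[X], hasseDeriv s (h ^ N) = h ^ (N - s) * w ∧
      w.natDegree ≤ s * D := by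
  intro N
  induction N with
  | zero =>
    intro s
    refine ⟨hasseDeriv s 1, by simp, ?_⟩
    exact (natDegree_hasseDeriv_le _ _).trans (by simp)
  | succ N ih =>
    intro s
    rcases Nat.eq_zero_or_pos s with rfl | hs0
    · exact ⟨1, by simp, by simp⟩
    by_cases hsN : N < s
    · refine ⟨hasseDeriv s (h ^ (N + 1)), by simp [show N + 1 - s = 0 by omega], ?_⟩
      refine (natDegree_hasseDeriv_le _ _).trans ((Nat.sub_le _ _).trans ?_)
      refine natDegree_pow_le.trans ?_
      exact Nat.mul_le_mul (by omega) hD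
    choose w hw hwd using ih
    refine ⟨w s + ∑ ab ∈ (Finset.HasAntidiagonal.antidiagonal s).erase (0, s),
      h ^ (s - 1 - ab.2) * (hasseDeriv ab.1 h * w ab.2), ?_, ?_⟩
    · rw [pow_succ', hasseDeriv_mul, ← Finset.add_sum_erase _ _ (a := (0, s)) (by simp), mul_add]
      congr 1
      · simp only [hasseDeriv_zero']
        rw [hw s, ← mul_assoc, ← pow_succ']
        congr 2; omega
      · rw [Finset.mul_sum]
        refine Finset.sum_congr rfl ?_
        rintro ⟨a, b⟩ hab
        simp only [Finset.mem_erase, Finset.HasAntidiagonal.mem_antidiagonal, ne_eq, Prod.mk.injEq] at hab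
        have hb : b + 1 ≤ s := by omega
        rw [hw b]
        have : N - b = (N + 1 - s) + (s - 1 - b) := by omega
        simp only [this, pow_add]
        ring
    · refine natDegree_add_le_of_degree_le (hwd s) (natDegree_sum_le_of_forall_le _ _ ?_)
      rintro ⟨a, b⟩ hab
      simp only [Finset.mem_erase, Finset.HasAntidiagonal.mem_antidiagonal, ne_eq, Prod.mk.injEq] at hab
      have h1 : natDegree (h ^ (s - 1 - b)) ≤ (s - 1 - b) * D :=
        natDegree_pow_le.trans (Nat.mul_le_mul le_rfl hD)
      have h2 : natDegree (hasseDeriv a h) ≤ D :=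
        (natDegree_hasseDeriv_le _ _).trans ((Nat.sub_le _ _).trans hD)
      have h3 := hwd b
      refine natDegree_mul_le.trans ?_
      have h4 : natDegree (hasseDeriv a h * w b) ≤ D + b * D :=
        natDegree_mul_le.trans (add_le_add h2 h3)
      have : s * D = (s - 1 - b) * D + (D + b * D) := by
        have : s = (s - 1 - b) + (1 + b) := by omega
        conv_lhs => rw [this]
        ring
      simp only
      omega

lemma st_T {K : Type*} [Field K] (h : K[X]) (D : ℕ) (hD : h.natDegree ≤ D) (N s : ℕ)
    (hs : s ≤ N) : ∃ T : K[X] →ₗ[K] K[X], ∀ k, hasseDeriv s (h ^ N * k) = h ^ (N - s) * T k ∧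
      (T k).natDegree ≤ k.natDegree + s * D := by
  choose w hw hwd using st_hd_pow h D hD N
  refine ⟨∑ ab ∈ Finset.HasAntidiagonal.antidiagonal s,
    (LinearMap.mulLeft K (h ^ ab.2 * w ab.1)) ∘ₗ (hasseDeriv ab.2), fun k => ⟨?_, ?_⟩⟩
  · rw [hasseDeriv_mul, LinearMap.sum_apply, Finset.mul_sum]
    refine Finset.sum_congr rfl ?_
    rintro ⟨a, b⟩ hab
    simp only [Finset.HasAntidiagonal.mem_antidiagonal] at hab
    have : N - a = (N - s) + b := by omega
    simp only [LinearMap.comp_apply, LinearMap.mulLeft_apply, hw, this, pow_add]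
    ring
  · rw [LinearMap.sum_apply]
    refine natDegree_sum_le_of_forall_le _ _ ?_
    rintro ⟨a, b⟩ hab
    simp only [Finset.HasAntidiagonal.mem_antidiagonal] at hab
    simp only [LinearMap.comp_apply, LinearMap.mulLeft_apply]
    have h1 : natDegree (h ^ b) ≤ b * D :=
      natDegree_pow_le.trans (Nat.mul_le_mul le_rfl hD)
    have h2 : natDegree (hasseDeriv b k) ≤ k.natDegree :=
      (natDegree_hasseDeriv_le _ _).trans (Nat.sub_le _ _)
    have h3 := hwd a
    have h4 : natDegree (h ^ b * w a) ≤ b * D + a * D :=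
        natDegree_mul_le.trans (add_le_add h1 h3)
    refine natDegree_mul_le.trans ?_
    rw [← hab, add_mul]
    omega

lemma st_nonvanish {K : Type*} [Field K] (h h1 : K[X]) (hh : h = X * h1) (h10 : h1.eval 0 ≠ 0)
    (r B J Q : ℕ) (hr : r * B + 1 = Q) (k : Fin r × Fin J → K[X])
    (hk : ∀ ij, (k ij).degree < B)
    (hsum : ∑ ij, k ij * h ^ (ij.1.1 * B) * X ^ (ij.2.1 * Q) = 0) : ∀ ij, k ij = 0 := by
  classical
  by_contra! hne
  obtain ⟨ij0, hij0⟩ := hne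
  obtain ⟨⟨i, j⟩, hm, hmin⟩ := Finset.exists_min_image (Finset.univ.filter fun ij => k ij ≠ 0)
    (fun ij => ij.1.1 * B + ij.2.1 * Q) ⟨ij0, by simpa using hij0⟩
  simp only [Finset.mem_filter, Finset.mem_univ, true_and] at hm hmin
  have hiB : ∀ i : Fin r, (i.1 + 1) * B + 1 ≤ Q := fun i => by
    rw [← hr]; exact Nat.add_le_add_right (Nat.mul_le_mul_right _ i.2) _
  have key : ∀ ij', ij' ≠ (i, j) → X ^ (i.1 * B + j.1 * Q + B) ∣
      k ij' * h ^ (ij'.1.1 * B) * X ^ (ij'.2.1 * Q) := by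
    rintro ⟨i', j'⟩ hne
    by_cases hk0 : k (i', j') = 0
    · simp [hk0]
    have h2 := hmin _ hk0
    simp only at h2 ⊢
    have h3 : i.1 * B + j.1 * Q + B ≤ i'.1 * B + j'.1 * Q := by
      have e1 := hiB i
      have e2 := hiB i'
      rcases lt_trichotomy j.1 j'.1 with hj | hj | hj
      · have : (j.1 + 1) * Q ≤ j'.1 * Q := Nat.mul_le_mul_right _ hj
        nlinarith
      · have hi : i ≠ i' := by
          rintro rfl
          exact hne (by rw [Fin.ext hj])
        rw [hj] at h2 ⊢
        have hi2 : i.1 < i'.1 := by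
          by_contra hlt
          have hlt2 : i'.1 + 1 ≤ i.1 := by
            have : i.1 ≠ i'.1 := fun h => hi (Fin.ext h)
            omega
          have : (i'.1 + 1) * B ≤ i.1 * B := Nat.mul_le_mul_right _ hlt2
          have hB0 : B = 0 := by nlinarith
          have := hk (i', j')
          rw [hB0] at this
          simp at this
          exact hk0 this
        have : (i.1 + 1) * B ≤ i'.1 * B := Nat.mul_le_mul_right _ hi2
        nlinarith
      · exfalso
        have : (j'.1 + 1) * Q ≤ j.1 * Q := Nat.mul_le_mul_right _ hj
        nlinarith
    rw [hh, mul_pow]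
    have h4 : X ^ (i'.1 * B + j'.1 * Q) ∣
        k (i', j') * (X ^ (i'.1 * B) * h1 ^ (i'.1 * B)) * X ^ (j'.1 * Q) :=
      ⟨k (i', j') * h1 ^ (i'.1 * B), by rw [pow_add]; ring⟩
    exact (pow_dvd_pow _ h3).trans h4
  rw [← Finset.add_sum_erase _ _ (Finset.mem_univ (i, j))] at hsum
  have hd : X ^ (i.1 * B + j.1 * Q + B) ∣ k (i, j) * h ^ (i.1 * B) * X ^ (j.1 * Q) := by
    rw [eq_neg_of_add_eq_zero_left hsum, dvd_neg]
    exact Finset.dvd_sum fun x hx => key x (Finset.ne_of_mem_erase hx)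
  have hd2 : X ^ (i.1 * B + j.1 * Q) * X ^ B ∣
      X ^ (i.1 * B + j.1 * Q) * (k (i, j) * h1 ^ (i.1 * B)) := by
    rw [← pow_add]
    convert hd using 1
    rw [hh, mul_pow, pow_add]; ring
  have hd3 := (mul_dvd_mul_iff_left (pow_ne_zero _ X_ne_zero)).1 hd2
  have hcop : IsCoprime (X ^ B : K[X]) (h1 ^ (i.1 * B)) := by
    apply IsCoprime.pow
    rw [Irreducible.coprime_iff_not_dvd irreducible_X, X_dvd_iff, coeff_zero_eq_eval_zero]
    exact h10
  have hd4 := hcop.dvd_of_dvd_mul_right hd3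
  apply hm
  refine eq_zero_of_dvd_of_degree_lt hd4 ?_
  simpa using hk (i, j)

open Polynomial

lemma st_dvd {K : Type*} [Field K] (f : K[X]) (b : K) (M : ℕ)
    (hf : ∀ s < M, (hasseDeriv s f).eval b = 0) : (X - C b) ^ M ∣ f := by
  have h1 : X ^ M ∣ taylor b f := by
    rw [X_pow_dvd_iff]
    intro s hs
    rw [taylor_coeff]
    exact hf s hs
  obtain ⟨u, hu⟩ := h1
  refine ⟨taylor (-b) u, ?_⟩
  have h2 := congrArg (taylor (-b)) hu
  rw [taylor_taylor, taylor_mul, taylor_pow, taylor_X] at h2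
  simpa [sub_eq_add_neg] using h2

theorem st_main {K : Type*} [Field K] [Fintype K] [DecidableEq K] (h h1 : K[X])
    (hh : h = X * h1) (h10 : h1.eval 0 ≠ 0)
    (D : ℕ) (hD : h.natDegree ≤ D) (r B : ℕ) (hr : r * B + 1 = Fintype.card K)
    (M J : ℕ) (hM : M ≤ Fintype.card K)
    (hcount : M * (B + M * D + J) < r * J * B) (c : K) :
    M * (Finset.univ.filter fun b : K => h.eval b ^ B = c).card ≤
      M * D + B + r * B * D + J * Fintype.card K := by
  classical
  set Q := Fintype.card K with hQ
  set L := B + M * D + J with hL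
  have hh0 : h ≠ 0 := by
    rintro h0
    rw [h0] at hh
    have : h1 = 0 := by
      rcases mul_eq_zero.1 hh.symm with h | h
      · exact absurd h X_ne_zero
      · exact h
    simp [this] at h10
  have hT := fun (i : Fin r) (s : Fin M) => st_T h D hD (M + i.1 * B) s.1 (by omega)
  choose T hT using hT
  -- the linear system
  let lin : (Fin r × Fin J → degreeLT K B) →ₗ[K] (Fin M → K[X]) :=
    LinearMap.pi fun s => ∑ ij : Fin r × Fin J,
      (LinearMap.mulLeft K (C (c ^ ij.1.1) * X ^ ij.2.1)) ∘ₗ (T ij.1 s) ∘ₗ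
        (degreeLT K B).subtype ∘ₗ LinearMap.proj ij
  have hlin : ∀ k s, lin k s = ∑ ij : Fin r × Fin J,
      C (c ^ ij.1.1) * X ^ ij.2.1 * T ij.1 s (k ij : K[X]) := by
    intro k s
    simp [lin, LinearMap.sum_apply, mul_assoc]
  let phi : (Fin r × Fin J → degreeLT K B) →ₗ[K] (Fin M × Fin L → K) :=
    LinearMap.pi fun sl => lcoeff K sl.2.1 ∘ₗ LinearMap.proj sl.1 ∘ₗ lin
  have hker : LinearMap.ker phi ≠ ⊥ := by
    apply LinearMap.ker_ne_bot_of_finrank_lt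
    rw [Module.finrank_pi_fintype, Module.finrank_pi_fintype]
    simp only [(degreeLTEquiv K B).finrank_eq, Module.finrank_pi]
    simpa using hcount
  obtain ⟨k, hk, hk0⟩ := (Submodule.ne_bot_iff _).1 hker
  have hdegk : ∀ ij, (k ij : K[X]).degree < B := fun ij => mem_degreeLT.1 (k ij).2
  have hk1 : ∀ s, lin k s = 0 := by
    intro s
    ext l
    rw [coeff_zero]
    by_cases hl : l < L
    · have := congrFun (LinearMap.mem_ker.1 hk) (s, ⟨l, hl⟩)
      simpa [phi] using this
    · apply coeff_eq_zero_of_degree_lt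
      refine lt_of_lt_of_le ?_ (show (L : WithBot ℕ) ≤ l by exact_mod_cast not_lt.1 hl)
      rw [hlin, ← mem_degreeLT]
      refine Submodule.sum_mem _ fun ij _ => ?_
      rw [mem_degreeLT]
      by_cases hz : (k ij : K[X]) = 0
      · simp [hz]
      have e1 : (k ij : K[X]).natDegree < B := (natDegree_lt_iff_degree_lt hz).2 (hdegk ij)
      have e2 := (hT ij.1 s (k ij)).2
      refine lt_of_le_of_lt degree_le_natDegree ?_
      have e3 : (C (c ^ ij.1.1) * X ^ ij.2.1 * T ij.1 s (k ij : K[X])).natDegree ≤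
          ij.2.1 + ((k ij : K[X]).natDegree + s * D) :=
        natDegree_mul_le.trans (add_le_add (natDegree_C_mul_X_pow_le _ _) e2)
      have e4 : s.1 * D ≤ M * D := Nat.mul_le_mul_right _ s.2.le
      have := ij.2.2
      exact_mod_cast (show _ < L by omega)
  set P : K[X] := ∑ ij : Fin r × Fin J,
    (k ij : K[X]) * h ^ (ij.1.1 * B) * X ^ (ij.2.1 * Q) with hP
  have hP0 : P ≠ 0 := by
    intro h0
    apply hk0
    funext ij
    exact Subtype.ext (st_nonvanish h h1 hh h10 r B J Q hr (fun ij => (k ij : K[X])) hdegk h0 ij)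
  set R := h ^ M * P with hR
  have hR0 : R ≠ 0 := mul_ne_zero (pow_ne_zero _ hh0) hP0
  have hdiv : ∀ b : K, h.eval b ^ B = c → (X - C b) ^ M ∣ R := by
    intro b hb
    obtain ⟨p, hp⟩ := CharP.exists K
    obtain ⟨m, hpp, hpm⟩ := FiniteField.card K p
    have := Fact.mk hpp
    have hXQ : (X - C b) ^ M ∣ (X ^ Q - C b : K[X]) := by
      have : (X ^ Q - C b : K[X]) = (X - C b) ^ Q := by
        conv_rhs => rw [hQ, hpm, sub_pow_char_pow, ← hpm, ← C_pow, FiniteField.pow_card]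
      rw [this]
      exact pow_dvd_pow _ hM
    set R' := ∑ ij : Fin r × Fin J, C (b ^ ij.2.1) * (h ^ (M + ij.1.1 * B) * (k ij : K[X]))
    have hRR : (X - C b) ^ M ∣ R - R' := by
      rw [hR, hP, Finset.mul_sum, ← Finset.sum_sub_distrib]
      refine Finset.dvd_sum fun ij _ => ?_
      have e1 : (X - C b) ^ M ∣ (X ^ (ij.2.1 * Q) - C (b ^ ij.2.1) : K[X]) := by
        rw [mul_comm, pow_mul, C_pow]
        exact hXQ.trans (sub_dvd_pow_sub_pow _ _ _)
      refine e1.trans ⟨h ^ (M + ij.1.1 * B) * (k ij : K[X]), ?_⟩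
      rw [pow_add]
      ring
    have hR' : (X - C b) ^ M ∣ R' := by
      apply st_dvd
      intro s hs
      have e1 : ∀ ij : Fin r × Fin J,
          (hasseDeriv s (C (b ^ ij.2.1) * (h ^ (M + ij.1.1 * B) * (k ij : K[X])))).eval b =
          h.eval b ^ (M - s) * (C (c ^ ij.1.1) * X ^ ij.2.1 * T ij.1 ⟨s, hs⟩ (k ij : K[X])).eval b := by
        intro ij
        rw [← smul_eq_C_mul, map_smul, (hT ij.1 ⟨s, hs⟩ (k ij)).1]
        have : M + ij.1.1 * B - s = (M - s) + B * ij.1.1 := by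
          rw [mul_comm B]; omega
        simp only [this, eval_smul, eval_mul, eval_pow, pow_add, pow_mul, hb, eval_C, eval_X,
          smul_eq_mul]
        ring
      rw [map_sum, eval_finsetSum, Finset.sum_congr rfl fun ij _ => e1 ij, ← Finset.mul_sum,
        ← eval_finsetSum, ← hlin, hk1]
      simp
    have := dvd_add hRR hR'
    simpa using this
  have hprod : (∏ b ∈ Finset.univ.filter fun b : K => h.eval b ^ B = c, (X - C b) ^ M) ∣ R := by
    apply Finset.prod_dvd_of_coprime
    · intro a _ b _ hab
      exact (isCoprime_X_sub_C_of_isUnit_sub (sub_ne_zero.2 hab).isUnit).pow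
    · intro b hb
      exact hdiv b (by simpa using hb)
  have hdeg := natDegree_le_of_dvd hprod hR0
  rw [natDegree_prod_of_monic _ _ (fun b _ => (monic_X_sub_C b).pow M)] at hdeg
  simp only [natDegree_pow, natDegree_X_sub_C, Finset.sum_const, smul_eq_mul, mul_one] at hdeg
  rw [mul_comm]
  refine hdeg.trans ?_
  have e1 : (h ^ M).natDegree ≤ M * D := natDegree_pow_le.trans (Nat.mul_le_mul_left _ hD)
  have e2 : P.natDegree ≤ B + r * B * D + J * Q := by
    refine natDegree_sum_le_of_forall_le _ _ fun ij _ => ?_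
    have f1 : (k ij : K[X]).natDegree ≤ B := natDegree_le_of_degree_le (hdegk ij).le
    have f2 : (h ^ (ij.1.1 * B)).natDegree ≤ r * B * D :=
      natDegree_pow_le.trans (Nat.mul_le_mul (Nat.mul_le_mul_right _ ij.1.2.le) hD)
    have f3 : (X ^ (ij.2.1 * Q) : K[X]).natDegree ≤ J * Q := by
      rw [natDegree_X_pow]; exact Nat.mul_le_mul_right _ ij.2.2.le
    exact natDegree_mul_le.trans (add_le_add (natDegree_mul_le.trans (add_le_add f1 f2)) f3)
  have := (natDegree_mul_le (p := h ^ M) (q := P))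
  rw [← hR] at this
  omega

open Polynomial

theorem st_bound {K : Type*} [Field K] [Fintype K] [DecidableEq K] (h h1 : K[X])
    (hh : h = X * h1) (h10 : h1.eval 0 ≠ 0)
    (D : ℕ) (hD : h.natDegree ≤ D) (r B M : ℕ) (hr0 : 0 < r) (hr : r * B + 1 = M ^ 2)
    (hM : Fintype.card K = M ^ 2) (c : K) :
    r * (Finset.univ.filter fun b : K => h.eval b ^ B = c).card ≤
      M ^ 2 + (1 + r * (4 * D + 10)) * M := by
  set N := (Finset.univ.filter fun b : K => h.eval b ^ B = c).card with hN
  have hN1 : N ≤ M ^ 2 := by rw [← hM]; exact Finset.card_le_univ _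
  by_cases hMs : M < D + 5
  · have : r * N ≤ r * (M * (D + 5)) := by
      refine Nat.mul_le_mul_left _ (hN1.trans ?_)
      rw [pow_two]; exact Nat.mul_le_mul_left _ hMs.le
    nlinarith [Nat.zero_le (r * D * M), Nat.zero_le (r * M), sq_nonneg M]
  push Not at hMs
  obtain ⟨x, hx⟩ : ∃ x, x = M / r := ⟨_, rfl⟩
  have hx1 : r * x ≤ M := by rw [hx]; exact Nat.mul_div_le _ _
  have hx2 : M < r * (x + 1) := by
    rw [hx]; exact Nat.lt_mul_div_succ M hr0
  have hx3 : x ≤ M := by rw [hx]; exact Nat.div_le_self _ _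
  have key := st_main h h1 hh h10 D hD r B (hr.trans hM.symm) M (x + D + 3)
    (by rw [hM]; nlinarith) ?_ c
  · rw [← hN, hM] at key
    have hMpos : 0 < M := by omega
    refine Nat.le_of_mul_le_mul_left ?_ hMpos
    have k2 := Nat.mul_le_mul_left r key
    have e1 : r * (x * M ^ 2) ≤ M * M ^ 2 := by
      rw [← mul_assoc]; exact Nat.mul_le_mul_right _ hx1
    have e2 : r * B ≤ M ^ 2 := by omega
    have e3 : r * (r * B * D) ≤ r * (M ^ 2 * D) :=
      Nat.mul_le_mul_left _ (Nat.mul_le_mul_right _ e2)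
    have e4 : r * (M * D) ≤ r * (M ^ 2 * D) := by
      refine Nat.mul_le_mul_left _ (Nat.mul_le_mul_right _ ?_)
      nlinarith
    calc M * (r * N) = r * (M * N) := by ring
      _ ≤ _ := k2
      _ = r * (M * D) + r * B + r * (r * B * D) + r * (x * M ^ 2) + r * (D + 3) * M ^ 2 := by ring
      _ ≤ r * (M ^ 2 * D) + M ^ 2 + r * (M ^ 2 * D) + M * M ^ 2 + r * (D + 3) * M ^ 2 := by
        gcongr
      _ ≤ _ := by
        nlinarith [Nat.zero_le (r * D * M ^ 2), Nat.zero_le (r * M ^ 2)]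
  · have e1 : (M + r * (D + 2)) * B ≤ r * (x + D + 3) * B := by
      apply Nat.mul_le_mul_right
      nlinarith
    refine lt_of_lt_of_le ?_ e1
    have e2 : (M + r * (D + 2)) * B = M * B + (D + 2) * (r * B) := by ring
    rw [e2]
    have e3 : M * x ≤ M * M := Nat.mul_le_mul_left _ hx3
    have e4 : (D + 2) * (r * B) + (D + 2) = (D + 2) * M ^ 2 := by rw [← hr]; ring
    have e5 : M * (D + 5) ≤ M * M := Nat.mul_le_mul_left _ hMs
    nlinarith

theorem st_bound' {K : Type*} [Field K] [Fintype K] [DecidableEq K] (h h1 : K[X]) (a : K)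
    (hh : h = (X - C a) * h1) (h10 : h1.eval a ≠ 0)
    (D : ℕ) (hD : h.natDegree ≤ D) (r B M : ℕ) (hr0 : 0 < r) (hr : r * B + 1 = M ^ 2)
    (hM : Fintype.card K = M ^ 2) (c : K) :
    r * (Finset.univ.filter fun b : K => h.eval b ^ B = c).card ≤
      M ^ 2 + (1 + r * (4 * D + 10)) * M := by
  have := st_bound (h.comp (X + C a)) (h1.comp (X + C a)) (by rw [hh]; simp) (by simpa using h10)
    D (by simpa [natDegree_comp] using hD) r B M hr0 hr hM c
  refine le_trans (le_of_eq ?_) this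
  congr 1
  refine Finset.card_bij (fun b _ => b - a) ?_ ?_ ?_
  · intro b hb; simpa using hb
  · intro b _ b' _ h; simpa using h
  · intro b hb
    exact ⟨b + a, by simpa using hb, by simp⟩

theorem st_charsum {E K : Type*} [Field E] [Fintype E] [DecidableEq E] [Field K] [Fintype K]
    [DecidableEq K] [Algebra E K]
    (χ : MulChar E ℂ) (hχ : χ ≠ 1) (h h1 : K[X]) (a : K)
    (hh : h = (X - C a) * h1) (h10 : h1.eval a ≠ 0)
    (D : ℕ) (hD : h.natDegree ≤ D) (r B M : ℕ) (hr0 : 0 < r) (hr : r * B + 1 = M ^ 2)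
    (hrE : Fintype.card E = r + 1)
    (hM : Fintype.card K = M ^ 2) (u : K → E) (hu : ∀ b, algebraMap E K (u b) = h.eval b ^ B) :
    ‖∑ b, χ (u b)‖ ≤ ((1 + r * (4 * D + 10) + D : ℕ) : ℝ) * M := by
  classical
  set N : E → ℕ := fun e => (Finset.univ.filter fun b : K => u b = e).card with hN
  have hB : B ≠ 0 := by
    rintro rfl
    have : 1 < Fintype.card K := Fintype.one_lt_card
    omega
  have hh0 : h ≠ 0 := by
    rintro h0
    rw [h0] at hh
    have : h1 = 0 := by
      rcases mul_eq_zero.1 hh.symm with h | h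
      · exact absurd h (X_sub_C_ne_zero a)
      · exact h
    simp [this] at h10
  have hN1 : ∀ e, r * N e ≤ M ^ 2 + (1 + r * (4 * D + 10)) * M := by
    intro e
    have := st_bound' h h1 a hh h10 D hD r B M hr0 hr hM (algebraMap E K e)
    refine le_trans (le_of_eq ?_) this
    simp only [hN, ← hu, (algebraMap E K).injective.eq_iff]
  have hMpos : 1 ≤ M := by
    by_contra hM0
    obtain rfl : M = 0 := by omega
    omega
  have hN0 : N 0 ≤ D := by
    refine le_trans (le_trans (Finset.card_le_card (t := h.roots.toFinset) ?_)
      ((Multiset.toFinset_card_le _).trans (card_roots' h))) hD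
    intro b hb
    simp only [Finset.mem_filter, Finset.mem_univ, true_and] at hb
    have := hu b
    rw [hb, map_zero] at this
    simp only [Multiset.mem_toFinset, mem_roots hh0, IsRoot]
    exact eq_zero_of_pow_eq_zero this.symm
  have hNsum : ∑ e, N e = M ^ 2 := by
    rw [← hM, ← Finset.card_univ]
    exact (Finset.card_eq_sum_card_fiberwise (f := u) (t := Finset.univ) (by simp)).symm
  have hsum : ∑ b, χ (u b) = ∑ e, (N e : ℂ) * χ e := by
    rw [← Finset.sum_fiberwise_of_maps_to (s := Finset.univ) (t := Finset.univ) (g := u)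
      (by simp)]
    refine Finset.sum_congr rfl fun e _ => ?_
    rw [Finset.sum_congr rfl (g := fun _ => χ e)]
    · simp [hN]
    · intro b hb
      simp only [Finset.mem_filter, Finset.mem_univ, true_and] at hb
      rw [hb]
  set Y : ℝ := ((M : ℝ) ^ 2 + (1 + r * (4 * D + 10) : ℕ) * M) / r with hY
  have hrpos : (0 : ℝ) < r := by exact_mod_cast hr0
  have hx : ∀ e, 0 ≤ Y - N e := by
    intro e
    rw [sub_nonneg, hY, le_div_iff₀ hrpos, mul_comm]
    exact_mod_cast hN1 e
  have hsum2 : ∑ b, χ (u b) = - ∑ e ∈ Finset.univ.erase (0 : E), ((Y - N e : ℝ) : ℂ) * χ e := by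
    rw [hsum]
    have e1 : ∑ e : E, ((Y - N e : ℝ) : ℂ) * χ e = - ∑ e, (N e : ℂ) * χ e := by
      have : ∑ e : E, (Y : ℂ) * χ e = 0 := by
        rw [← Finset.mul_sum, MulChar.sum_eq_zero_of_ne_one hχ, mul_zero]
      push_cast
      simp only [sub_mul, Finset.sum_sub_distrib, this, zero_sub]
    rw [← Finset.add_sum_erase _ _ (Finset.mem_univ (0 : E))] at e1
    have e2 : χ (0 : E) = 0 := MulChar.map_zero χ
    rw [e2, mul_zero, zero_add] at e1
    rw [e1, neg_neg]
  rw [hsum2, norm_neg]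
  refine (norm_sum_le _ _).trans ?_
  have hle : ∀ e ∈ Finset.univ.erase (0 : E), ‖((Y - N e : ℝ) : ℂ) * χ e‖ ≤ Y - N e := by
    intro e he
    have hχe : ‖χ e‖ = 1 := by
      have he0 : e ≠ 0 := Finset.ne_of_mem_erase he
      refine Complex.norm_eq_one_of_pow_eq_one (n := r) ?_ hr0.ne'
      rw [← map_pow, show r = Fintype.card E - 1 by omega, FiniteField.pow_card_sub_one_eq_one e he0,
        map_one]
    rw [norm_mul, hχe, mul_one, Complex.norm_real, Real.norm_of_nonneg (hx e)]
  refine (Finset.sum_le_sum hle).trans ?_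
  have h3 : ∑ e ∈ Finset.univ.erase (0 : E), (Y - N e) = r * Y - (M ^ 2 - N 0) := by
    rw [Finset.sum_sub_distrib, Finset.sum_const, Finset.card_erase_of_mem (Finset.mem_univ _),
      Finset.card_univ, hrE]
    have : (N 0 : ℝ) + ∑ e ∈ Finset.univ.erase (0 : E), (N e : ℝ) = M ^ 2 := by
      rw [Finset.add_sum_erase _ (fun e => (N e : ℝ)) (Finset.mem_univ _)]
      exact_mod_cast hNsum
    simp only [Nat.add_sub_cancel, nsmul_eq_mul]
    linarith
  rw [h3]
  have h4 : r * Y = (M : ℝ) ^ 2 + (1 + r * (4 * D + 10) : ℕ) * M := by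
    rw [hY]; field_simp
  have h5 : (N 0 : ℝ) ≤ D := by exact_mod_cast hN0
  have h6 : (D : ℝ) ≤ D * M := by
    have : (1 : ℝ) ≤ M := by exact_mod_cast hMpos
    nlinarith [Nat.cast_nonneg (α := ℝ) D]
  rw [h4]
  push_cast
  nlinarith

open Polynomial

lemma bb_recur {ι : Type*} [Fintype ι] (u : ι → ℂ) (hu : ∀ i, ‖u i‖ = 1) (k0 : ℕ) :
    ∃ k, k0 ≤ k ∧ ∀ i, 1 / 2 ≤ (u i ^ k).re := by
  have hc : IsCompact (Metric.closedBall (0 : ι → ℂ) 1) := isCompact_closedBall _ _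
  obtain ⟨a, -, φ, hφ, hlim⟩ := hc.tendsto_subseq (x := fun k i => u i ^ k) (by
    intro k
    rw [mem_closedBall_zero_iff, pi_norm_le_iff_of_nonneg zero_le_one]
    intro i; simp [hu])
  have hcau := hlim.cauchySeq
  rw [Metric.cauchySeq_iff'] at hcau
  obtain ⟨N, hN⟩ := hcau (1 / 2) (by norm_num)
  have hle : φ N + k0 ≤ φ (N + k0) := by
    have := hφ.add_le_nat k0 N
    rw [add_comm k0 N] at this
    omega
  refine ⟨φ (N + k0) - φ N, by omega, fun i => ?_⟩
  have h1 := hN (N + k0) (by omega)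
  have h2 := (dist_le_pi_dist _ _ i).trans h1.le
  simp only [Function.comp] at h2
  set k := φ (N + k0) - φ N with hk
  have h3 : φ (N + k0) = φ N + k := by omega
  rw [h3, dist_eq_norm, pow_add, ← mul_sub_one, norm_mul, norm_pow, hu, one_pow, one_mul] at h2
  have h4 := (Complex.abs_re_le_norm _).trans h2
  rw [abs_le] at h4
  simp only [Complex.sub_re, Complex.one_re] at h4
  linarith [h4.1]

lemma bb_root {ι : Type*} [Fintype ι] (z : ι → ℂ) (A ρ : ℝ) (hρ : 0 < ρ)
    (hb : ∀ k : ℕ, 1 ≤ k → ‖∑ i, z i ^ k‖ ≤ A * ρ ^ k) (i : ι) : ‖z i‖ ≤ ρ := by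
  by_contra hlt
  push Not at hlt
  let u : ι → ℂ := fun i => if z i = 0 then 1 else z i / ‖z i‖
  have hu : ∀ i, ‖u i‖ = 1 := by
    intro i
    by_cases h : z i = 0
    · simp [u, h]
    · simp [u, h]
  have hzu : ∀ i, z i = ‖z i‖ * u i := by
    intro i
    by_cases h : z i = 0
    · simp [h]
    · have : (‖z i‖ : ℂ) ≠ 0 := by simpa using h
      simp only [u, h, if_false]
      field_simp
  have hx : 1 < ‖z i‖ / ρ := by rwa [one_lt_div hρ]
  obtain ⟨k0, hk0⟩ := pow_unbounded_of_one_lt (2 * A) hx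
  obtain ⟨k, hk, hre⟩ := bb_recur u hu (k0 + 1)
  have h1 : ‖z i‖ ^ k / 2 ≤ ‖∑ i, z i ^ k‖ := by
    refine le_trans ?_ (Complex.re_le_norm _)
    rw [Complex.re_sum]
    have h2 : ∀ j, ‖z j‖ ^ k / 2 ≤ (z j ^ k).re := by
      intro j
      conv_rhs => rw [hzu j, mul_pow, ← Complex.ofReal_pow, Complex.re_ofReal_mul]
      have := hre j
      have h3 : 0 ≤ ‖z j‖ ^ k := by positivity
      nlinarith
    refine (h2 i).trans (Finset.single_le_sum (f := fun j => (z j ^ k).re) ?_ (Finset.mem_univ i))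
    intro j _
    refine le_trans ?_ (h2 j)
    positivity
  have h2 := h1.trans (hb k (by omega))
  have h3 : (‖z i‖ / ρ) ^ k ≤ 2 * A := by
    rw [div_pow, div_le_iff₀ (by positivity)]
    linarith
  have h4 : (‖z i‖ / ρ) ^ k0 ≤ (‖z i‖ / ρ) ^ k := pow_le_pow_right₀ hx.le (by omega)
  linarith

lemma bb_prod (l : List ℂ) :
    PowerSeries.X * PowerSeries.derivative ℂ
      (l.map fun w => (1 - PowerSeries.C w * PowerSeries.X : PowerSeries ℂ)).prod =
    - PowerSeries.mk (fun m => if m = 0 then 0 else (l.map fun w => w ^ m).sum) *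
      (l.map fun w => (1 - PowerSeries.C w * PowerSeries.X : PowerSeries ℂ)).prod := by
  induction l with
  | nil =>
    have : PowerSeries.mk (fun m : ℕ => if m = 0 then (0 : ℂ) else 0) = 0 := by
      ext m; simp
    simp only [List.map_nil, List.prod_nil, List.sum_nil, this]
    simp [Derivation.map_one_eq_zero]
  | cons w l ih =>
    simp only [List.map_cons, List.prod_cons, List.sum_cons]
    set P := (l.map fun w => (1 - PowerSeries.C w * PowerSeries.X : PowerSeries ℂ)).prod
    set S := PowerSeries.mk (fun m => if m = 0 then 0 else (l.map fun w => w ^ m).sum)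
    have h1 : PowerSeries.mk (fun m => if m = 0 then 0 else w ^ m + (l.map fun w => w ^ m).sum) =
        PowerSeries.mk (fun m => if m = 0 then 0 else w ^ m) + S := by
      ext m
      simp only [S, map_add, PowerSeries.coeff_mk]
      split_ifs <;> simp
    have h2 : PowerSeries.mk (fun m => if m = 0 then 0 else w ^ m) *
        (1 - PowerSeries.C w * PowerSeries.X) = PowerSeries.C w * PowerSeries.X := by
      ext m
      rw [mul_sub, mul_one, map_sub, mul_left_comm, PowerSeries.coeff_C_mul,
        PowerSeries.coeff_C_mul]
      rcases m with _ | m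
      · simp
      · rw [PowerSeries.coeff_succ_mul_X, PowerSeries.coeff_X]
        rcases m with _ | m
        · simp
        · simp [pow_succ']
    have h3 : PowerSeries.derivative ℂ (1 - PowerSeries.C w * PowerSeries.X : PowerSeries ℂ) =
        - PowerSeries.C w := by
      ext m
      rw [PowerSeries.coeff_derivative, map_sub, PowerSeries.coeff_C_mul, PowerSeries.coeff_X,
        PowerSeries.coeff_one, map_neg, PowerSeries.coeff_C]
      rcases m with _ | m <;> simp
    rw [h1, Derivation.leibniz, h3]
    simp only [smul_eq_mul]
    linear_combination (1 - PowerSeries.C w * PowerSeries.X) * ih + P * h2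

lemma bb_newton (n : ℕ) (hn : 1 ≤ n) (a S : ℕ → ℂ) (ha0 : a 0 = 1) (ha : ∀ k, n ≤ k → a k = 0)
    (hrec : ∀ k : ℕ, ((k + 1 : ℕ) : ℂ) * a (k + 1) =
      ∑ j ∈ Finset.range (k + 1), S (j + 1) * a (k - j)) :
    ∃ l : List ℂ, l.length ≤ n - 1 ∧ ∀ m, 1 ≤ m → S m = - (l.map fun w => w ^ m).sum := by
  set A : ℂ[X] := ∑ k ∈ Finset.range n, C (a k) * X ^ k with hA
  have hAc : ∀ k, A.coeff k = a k := by
    intro k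
    simp only [hA, finsetSum_coeff, coeff_C_mul, coeff_X_pow, mul_ite, mul_one, mul_zero,
      Finset.sum_ite_eq, Finset.mem_range]
    split_ifs with h
    · rfl
    · exact (ha k (not_lt.1 h)).symm
  have hA0 : A ≠ 0 := by
    intro h
    have := hAc 0
    rw [h, ha0] at this
    simp at this
  have hdeg : A.natDegree ≤ n - 1 := by
    rw [natDegree_le_iff_coeff_eq_zero]
    intro N hN
    rw [hAc, ha N (by omega)]
  set l := A.roots.toList with hl
  have hroot0 : ∀ w ∈ l, w ≠ 0 := by
    rintro w hw rfl
    rw [hl, Multiset.mem_toList, mem_roots hA0, IsRoot, ← coeff_zero_eq_eval_zero, hAc, ha0] at hw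
    exact one_ne_zero hw
  have hfac : A = C A.leadingCoeff * (l.map fun w => X - C w).prod := by
    conv_lhs => rw [(IsAlgClosed.splits A).eq_prod_roots]
    congr 1
    conv_lhs => rw [← Multiset.coe_toList A.roots]
    rw [Multiset.map_coe, Multiset.prod_coe]
  have hfac2 : ∀ l : List ℂ, (∀ w ∈ l, w ≠ 0) → ∃ c : ℂ, (l.map fun w => X - C w).prod =
      C c * ((l.map fun w => w⁻¹).map fun w => 1 - C w * X).prod := by
    intro l
    induction l with
    | nil => intro _; exact ⟨1, by simp⟩
    | cons w l ih =>
      intro h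
      obtain ⟨c, hc⟩ := ih fun w hw => h w (by simp [hw])
      have hw : w ≠ 0 := h w (by simp)
      refine ⟨-w * c, ?_⟩
      simp only [List.map_cons, List.prod_cons, hc, C_mul, C_neg]
      have : (X - C w : ℂ[X]) = - C w * (1 - C w⁻¹ * X) := by
        have : C w * C w⁻¹ = (1 : ℂ[X]) := by rw [← C_mul, mul_inv_cancel₀ hw, C_1]
        linear_combination (-X) * this
      rw [this]; ring
  obtain ⟨c, hc⟩ := hfac2 l hroot0
  set l' := l.map fun w => w⁻¹ with hl'
  have hAprod : A = (l'.map fun w => 1 - C w * X).prod := by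
    rw [hc, ← mul_assoc, ← C_mul] at hfac
    have : A.leadingCoeff * c = 1 := by
      have h0 := congrArg (eval 0) hfac
      rw [← coeff_zero_eq_eval_zero, hAc, ha0, eval_mul, eval_C, eval_list_prod, List.map_map] at h0
      rw [h0, List.prod_eq_one, mul_one]
      intro x hx
      obtain ⟨y, -, rfl⟩ := List.mem_map.1 hx
      simp
    rw [this, C_1, one_mul] at hfac
    exact hfac
  refine ⟨l', ?_, ?_⟩
  · rw [hl', List.length_map, hl, Multiset.length_toList]
    exact (card_roots' A).trans hdeg
  have hps : PowerSeries.mk a = (l'.map fun w =>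
      (1 - PowerSeries.C w * PowerSeries.X : PowerSeries ℂ)).prod := by
    have h1 : PowerSeries.mk a = (A : PowerSeries ℂ) := by
      ext k; simp [hAc]
    rw [h1, hAprod]
    have h2 := map_list_prod (coeToPowerSeries.ringHom (R := ℂ)) (l'.map fun w => 1 - C w * X)
    simp only [coeToPowerSeries.ringHom_apply] at h2
    rw [h2, List.map_map]
    congr 1
    apply List.map_congr_left
    intro w _
    simp
  have hp := bb_prod l'
  rw [← hps] at hp
  have hq : PowerSeries.X * PowerSeries.derivative ℂ (PowerSeries.mk a) =
      PowerSeries.mk (fun m => if m = 0 then 0 else S m) * PowerSeries.mk a := by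
    ext k
    rcases k with _ | k
    · simp
    · rw [PowerSeries.coeff_succ_X_mul, PowerSeries.coeff_derivative, PowerSeries.coeff_mk,
        PowerSeries.coeff_mul, Finset.Nat.sum_antidiagonal_eq_sum_range_succ_mk,
        Finset.sum_range_succ']
      have := hrec k
      simp only [PowerSeries.coeff_mk, if_true, zero_mul, add_zero]
      rw [mul_comm]
      push_cast at this
      rw [this]
      refine Finset.sum_congr rfl fun j _ => ?_
      rw [if_neg (by omega), Nat.add_sub_add_right]
  have hfin := mul_right_cancel₀ (show PowerSeries.mk a ≠ 0 by
    intro h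
    have := congrArg (PowerSeries.coeff 0) h
    simp [ha0] at this) (hq.symm.trans hp)
  intro m hm
  have := congrArg (PowerSeries.coeff m) hfin
  simpa [show m ≠ 0 by omega] using this

open Polynomial

section
variable (F : Type*) [Field F] [Fintype F]

lemma aa_fin (k : ℕ) : {g : F[X] | g.Monic ∧ g.natDegree = k}.Finite := by
  refine Set.Finite.of_finite_image (f := fun g => fun i : Fin (k + 1) => g.coeff i)
    (Set.toFinite _) ?_
  rintro g ⟨-, hg⟩ g' ⟨-, hg'⟩ h
  ext i
  by_cases hi : i < k + 1
  · exact congrFun h ⟨i, hi⟩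
  · rw [coeff_eq_zero_of_natDegree_lt (by omega), coeff_eq_zero_of_natDegree_lt (by omega)]

/-- monic polynomials of degree `k` -/
noncomputable def aaMon (k : ℕ) : Finset F[X] := (aa_fin F k).toFinset

lemma aa_mem_mon {k : ℕ} {g : F[X]} : g ∈ aaMon F k ↔ g.Monic ∧ g.natDegree = k := by
  simp [aaMon]

lemma aa_fin' (m : ℕ) : {x : F[X] × ℕ | (x.1.Monic ∧ Irreducible x.1) ∧ 0 < x.2 ∧
    x.2 * x.1.natDegree = m}.Finite := by
  classical
  refine Set.Finite.subset (((Finset.range (m + 1)).biUnion (aaMon F)) ×ˢ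
    (Finset.range (m + 1))).finite_toSet ?_
  rintro ⟨p, e⟩ ⟨⟨hp, hi⟩, he, hm⟩
  have hd : 0 < p.natDegree := hi.natDegree_pos
  simp only at he hm hp hi
  have h1 : e ≤ m := by rw [← hm]; exact Nat.le_mul_of_pos_right _ hd
  have h2 : p.natDegree ≤ m := by rw [← hm]; exact Nat.le_mul_of_pos_left _ he
  simp only [Finset.coe_product, Set.mem_prod, Finset.mem_coe, Finset.mem_biUnion,
    Finset.mem_range, aa_mem_mon]
  exact ⟨⟨p.natDegree, by omega, hp, rfl⟩, by omega⟩

/-- prime powers of degree `m` -/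
noncomputable def aaPP (m : ℕ) : Finset (F[X] × ℕ) := (aa_fin' F m).toFinset

lemma aa_mem_pp {m : ℕ} {x : F[X] × ℕ} : x ∈ aaPP F m ↔ (x.1.Monic ∧ Irreducible x.1) ∧ 0 < x.2 ∧
    x.2 * x.1.natDegree = m := by
  simp [aaPP]

variable {F}

lemma aa_pow_dvd [DecidableEq F] {g p : F[X]} (hg : g ≠ 0) (hp : p.Monic) (hi : Irreducible p)
    (e : ℕ) : p ^ e ∣ g ↔ e ≤ (UniqueFactorizationMonoid.normalizedFactors g).count p := by
  rw [pow_dvd_iff_le_emultiplicity,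
    UniqueFactorizationMonoid.emultiplicity_eq_count_normalizedFactors hi hg, hp.normalize_eq_self]
  exact Nat.cast_le

open Classical in
lemma aa_deg (k : ℕ) (g : F[X]) (hg : g ∈ aaMon F (k + 1)) :
    ∑ j ∈ Finset.range (k + 1), ∑ x ∈ (aaPP F (j + 1)).filter (fun x => x.1 ^ x.2 ∣ g),
      x.1.natDegree = k + 1 := by
  rw [aa_mem_mon] at hg
  obtain ⟨hgm, hgd⟩ := hg
  have hg0 : g ≠ 0 := hgm.ne_zero
  set s := UniqueFactorizationMonoid.normalizedFactors g with hs
  have hsp : ∀ p ∈ s, p.Monic ∧ Irreducible p := fun p hp =>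
    ⟨by
      have := UniqueFactorizationMonoid.normalize_normalized_factor p hp
      rw [← this]
      exact monic_normalize (UniqueFactorizationMonoid.irreducible_of_normalized_factor p hp).ne_zero,
     UniqueFactorizationMonoid.irreducible_of_normalized_factor p hp⟩
  have hprod : s.prod = g := by
    rw [hs, UniqueFactorizationMonoid.prod_normalizedFactors_eq hg0, hgm.normalize_eq_self]
  have hdeg : k + 1 = ∑ p ∈ s.toFinset, ∑ e ∈ Finset.Icc 1 (s.count p), p.natDegree := by
    rw [← hgd, ← hprod, natDegree_multiset_prod_of_monic _ (fun p hp => (hsp p hp).1),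
      Finset.sum_multiset_map_count]
    simp
  conv_rhs => rw [hdeg]
  rw [Finset.sum_sigma', Finset.sum_sigma']
  refine Finset.sum_bij' (fun y _ => ⟨y.2.1, y.2.2⟩)
    (fun y _ => ⟨y.2 * y.1.natDegree - 1, (y.1, y.2)⟩) ?_ ?_ ?_ ?_ ?_
  · rintro ⟨j, p, e⟩ h
    simp only [Finset.mem_sigma, Finset.mem_range, Finset.mem_filter, aa_mem_pp] at h
    obtain ⟨hj, ⟨⟨hp, hi⟩, he, hm⟩, hd⟩ := h
    rw [aa_pow_dvd hg0 hp hi] at hd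
    simp only [Finset.mem_sigma, Multiset.mem_toFinset, Finset.mem_Icc]
    refine ⟨?_, he, hd⟩
    rw [← Multiset.one_le_count_iff_mem]
    exact le_trans he hd
  · rintro ⟨p, e⟩ h
    simp only [Finset.mem_sigma, Multiset.mem_toFinset, Finset.mem_Icc] at h
    obtain ⟨hp, he, hc⟩ := h
    obtain ⟨hm, hi⟩ := hsp p hp
    have hd : 0 < p.natDegree := hi.natDegree_pos
    have h1 : 0 < e * p.natDegree := Nat.mul_pos he hd
    rw [← aa_pow_dvd hg0 hm hi] at hc
    have h2 := natDegree_le_of_dvd hc hg0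
    rw [natDegree_pow] at h2
    simp only [Finset.mem_sigma, Finset.mem_range, Finset.mem_filter, aa_mem_pp]
    exact ⟨by omega, ⟨⟨hm, hi⟩, he, by omega⟩, hc⟩
  · rintro ⟨j, p, e⟩ h
    simp only [Finset.mem_sigma, Finset.mem_range, Finset.mem_filter, aa_mem_pp] at h
    obtain ⟨hj, ⟨⟨hp, hi⟩, he, hm⟩, hd⟩ := h
    simp only [Sigma.mk.injEq, heq_eq_eq, and_true]
    omega
  · rintro ⟨p, e⟩ h
    rfl
  · rintro ⟨j, p, e⟩ h
    rfl

/-- character sums over monic polynomials -/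
noncomputable def aaA (f : F[X] →* ℂ) (k : ℕ) : ℂ := ∑ g ∈ aaMon F k, f g

/-- character sums over prime powers -/
noncomputable def aaS (f : F[X] →* ℂ) (m : ℕ) : ℂ :=
  ∑ x ∈ aaPP F m, (x.1.natDegree : ℂ) * f x.1 ^ x.2

lemma aa_rec (f : F[X] →* ℂ) (k : ℕ) : ((k + 1 : ℕ) : ℂ) * aaA f (k + 1) =
      ∑ j ∈ Finset.range (k + 1), aaS f (j + 1) * aaA f (k - j) := by
  classical
  have h1 : ((k + 1 : ℕ) : ℂ) * aaA f (k + 1) = ∑ g ∈ aaMon F (k + 1),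
      ∑ j ∈ Finset.range (k + 1), ∑ x ∈ (aaPP F (j + 1)).filter (fun x => x.1 ^ x.2 ∣ g),
      (x.1.natDegree : ℂ) * f g := by
    rw [aaA, Finset.mul_sum]
    refine Finset.sum_congr rfl fun g hg => ?_
    conv_lhs => rw [← aa_deg k g hg]
    push_cast
    rw [Finset.sum_mul]
    simp only [Finset.sum_mul]
  rw [h1, Finset.sum_comm]
  refine Finset.sum_congr rfl fun j hj => ?_
  rw [Finset.mem_range] at hj
  simp only [Finset.sum_filter]
  rw [Finset.sum_comm, aaS, Finset.sum_mul]
  refine Finset.sum_congr rfl fun x hx => ?_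
  rw [aa_mem_pp] at hx
  obtain ⟨⟨hp, hi⟩, he, hm⟩ := hx
  rw [← Finset.sum_filter, ← Finset.mul_sum, mul_assoc, aaA, Finset.mul_sum (aaMon F (k - j))]
  refine congrArg _ ?_
  symm
  have hpm : (x.1 ^ x.2).Monic := hp.pow _
  have hpd : (x.1 ^ x.2).natDegree = j + 1 := by rw [natDegree_pow, hm]
  refine Finset.sum_bij (fun g _ => x.1 ^ x.2 * g) ?_ ?_ ?_ ?_
  · intro g hg
    rw [aa_mem_mon] at hg
    rw [Finset.mem_filter, aa_mem_mon]
    refine ⟨⟨hpm.mul hg.1, ?_⟩, dvd_mul_right _ _⟩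
    rw [hpm.natDegree_mul hg.1, hpd, hg.2]
    omega
  · intro g _ g' _ h
    exact mul_left_cancel₀ hpm.ne_zero h
  · intro g hg
    rw [Finset.mem_filter, aa_mem_mon] at hg
    obtain ⟨⟨hgm, hgd⟩, g', rfl⟩ := hg
    have hg'm : g'.Monic := hpm.of_mul_monic_left hgm
    refine ⟨g', ?_, rfl⟩
    rw [aa_mem_mon]
    refine ⟨hg'm, ?_⟩
    rw [hpm.natDegree_mul hg'm, hpd] at hgd
    omega
  · intro g _
    rw [map_mul, map_pow]

lemma aa_zero (f : F[X] →* ℂ) : aaA f 0 = 1 := by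
  have : aaMon F 0 = {1} := by
    ext g
    rw [aa_mem_mon, Finset.mem_singleton]
    constructor
    · rintro ⟨h1, h2⟩
      exact h1.natDegree_eq_zero.1 h2
    · rintro rfl
      simp
  rw [aaA, this, Finset.sum_singleton, map_one]

lemma aa_vanish {E : Type*} [Field E] [Fintype E] [Algebra F E] (α : E) (χ : MulChar E ℂ)
    (hχ : χ ≠ 1) (n : ℕ) (hs : ∀ u : E, ∃ r : F[X], r.degree < n ∧ aeval α r = u)
    (k : ℕ) (hk : n ≤ k) : aaA (χ.toMonoidHom.comp (aeval (R := F) α : F[X] →* E)) k = 0 := by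
  set f : F[X] →* ℂ := χ.toMonoidHom.comp (aeval (R := F) α : F[X] →* E) with hf
  have hfa : ∀ g, f g = χ (aeval α g) := fun g => rfl
  have h1 : ∀ u : E, aaA f k = ∑ g ∈ aaMon F k, χ (aeval α g + u) := by
    intro u
    obtain ⟨r, hr, rfl⟩ := hs u
    have hshift : ∀ r : F[X], r.degree < n → ∀ g ∈ aaMon F k, g + r ∈ aaMon F k := by
      intro r hr g hg
      rw [aa_mem_mon] at hg ⊢
      have hgd : r.degree < g.degree := by
        rw [degree_eq_natDegree hg.1.ne_zero, hg.2]
        exact lt_of_lt_of_le hr (by exact_mod_cast hk)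
      exact ⟨hg.1.add_of_left hgd, by rw [natDegree_add_eq_left_of_degree_lt hgd, hg.2]⟩
    symm
    refine Finset.sum_bij' (fun g _ => g + r) (fun g _ => g + -r) (hshift r hr)
      (hshift (-r) (by rwa [degree_neg])) ?_ ?_ ?_
    · intro g _; ring
    · intro g _; ring
    · intro g _; rw [hfa, map_add (aeval α)]
  have h2 : (Fintype.card E : ℂ) * aaA f k = 0 := by
    calc (Fintype.card E : ℂ) * aaA f k = ∑ u : E, aaA f k := by simp
      _ = ∑ u : E, ∑ g ∈ aaMon F k, χ (aeval α g + u) := Finset.sum_congr rfl fun u _ => h1 u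
      _ = ∑ g ∈ aaMon F k, ∑ u : E, χ (aeval α g + u) := Finset.sum_comm
      _ = 0 := by
        refine Finset.sum_eq_zero fun g _ => ?_
        rw [← MulChar.sum_eq_zero_of_ne_one hχ]
        exact Fintype.sum_equiv (Equiv.addLeft (aeval α g)) _ _ fun u => rfl
  rcases mul_eq_zero.1 h2 with h | h
  · exact absurd h (by exact_mod_cast Fintype.card_ne_zero)
  · exact h

lemma aa_S_eq {K : Type*} [Field K] [Fintype K] [Algebra F K] (m : ℕ) (hm : 0 < m)
    (hK : Module.finrank F K = m) (f : F[X] →* ℂ) :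
    aaS f m = ∑ b : K, f (minpoly F b ^ (m / (minpoly F b).natDegree)) := by
  classical
  have hfin : Module.Finite F K := Module.Finite.of_finite
  have hint : ∀ b : K, IsIntegral F b := fun b => Algebra.IsIntegral.isIntegral b
  have hdvd : ∀ b : K, (minpoly F b).natDegree ∣ m := fun b => by
    rw [← hK]; exact minpoly.degree_dvd (hint b)
  have hmem : ∀ b : K, (minpoly F b, m / (minpoly F b).natDegree) ∈ aaPP F m := by
    intro b
    rw [aa_mem_pp]
    have hpos := minpoly.natDegree_pos (hint b)
    refine ⟨⟨minpoly.monic (hint b), minpoly.irreducible (hint b)⟩, ?_, ?_⟩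
    · exact Nat.div_pos (Nat.le_of_dvd hm (hdvd b)) hpos
    · exact Nat.div_mul_cancel (hdvd b)
  rw [← Finset.sum_fiberwise_of_maps_to (s := Finset.univ) (t := aaPP F m)
    (g := fun b : K => (minpoly F b, m / (minpoly F b).natDegree)) (fun b _ => hmem b), aaS]
  refine Finset.sum_congr rfl fun x hx => ?_
  obtain ⟨p, e⟩ := x
  rw [aa_mem_pp] at hx
  obtain ⟨⟨hp, hi⟩, he, hpe⟩ := hx
  simp only at hp hi he hpe
  have hset : (Finset.univ.filter fun b : K => (minpoly F b, m / (minpoly F b).natDegree) = (p, e)) =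
      (p.rootSet K).toFinset := by
    ext b
    simp only [Finset.mem_filter, Finset.mem_univ, true_and, Set.mem_toFinset, Prod.mk.injEq,
      mem_rootSet_of_ne hi.ne_zero]
    constructor
    · rintro ⟨h, -⟩
      rw [← h]; exact minpoly.aeval _ _
    · intro h
      have := (minpoly.eq_of_irreducible_of_monic hi h hp).symm
      refine ⟨this, ?_⟩
      rw [this, ← hpe]
      exact Nat.mul_div_cancel _ hi.natDegree_pos
  have hcardK : Fintype.card K = Nat.card F ^ m := by
    rw [Nat.card_eq_fintype_card, ← hK]
    exact Module.card_eq_pow_finrank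
  have hsplit : (p.map (algebraMap F K)).Splits := by
    have h1 : p ∣ X ^ (Nat.card F) ^ m - X := by
      rw [← Irreducible.natDegree_dvd_iff_dvd_X_pow_card_pow_sub_X hi]
      exact ⟨e, by rw [← hpe, mul_comm]⟩
    have h2 := (FiniteField.isSplittingField_sub K F).splits
    rw [hcardK] at h2
    refine Splits.of_dvd h2 ?_ (Polynomial.map_dvd _ h1)
    exact Polynomial.map_ne_zero (FiniteField.X_pow_card_pow_sub_X_ne_zero _ hm.ne' Finite.one_lt_card)
  have hsep : p.Separable := PerfectField.separable_of_irreducible hi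
  have hcard : (p.rootSet K).toFinset.card = p.natDegree := by
    rw [Set.toFinset_card]
    exact card_rootSet_eq_natDegree hsep hsplit
  rw [hset, Finset.sum_congr rfl (g := fun _ => f p ^ e), Finset.sum_const, hcard, nsmul_eq_mul]
  intro b hb
  rw [← hset, Finset.mem_filter, Prod.mk.injEq] at hb
  obtain ⟨-, h1, h2⟩ := hb
  rw [h2, h1, map_pow]
end

open Polynomial

lemma dd_frob {F K : Type*} [Field F] [Fintype F] [Field K] [Algebra F K] (i : ℕ) (x : K) :
    ((FiniteField.frobeniusAlgHom F K) ^ i) x = x ^ (Fintype.card F ^ i) := by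
  rw [AlgHom.coe_pow, FiniteField.coe_frobeniusAlgHom, pow_iterate]

lemma dd_sub (F : Type*) {K : Type*} [Field F] [Fintype F] [Field K] [Algebra F K] (i : ℕ) (x y : K) :
    (x - y) ^ (Fintype.card F ^ i) = x ^ (Fintype.card F ^ i) - y ^ (Fintype.card F ^ i) := by
  rw [← dd_frob, map_sub, dd_frob, dd_frob]

lemma dd_min {F K : Type*} [Field F] [Fintype F] [Field K] [Fintype K] [Algebra F K]
    (m : ℕ) (hK : Module.finrank F K = m) (b : K) :
    (minpoly F b ^ (m / (minpoly F b).natDegree)).map (algebraMap F K)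
      = ∏ i ∈ Finset.range m, (X - C (b ^ (Fintype.card F ^ i))) := by
  classical
  have hchar : (MulSemiringAction.charpoly Gal(K/F) b) =
      ∏ i ∈ Finset.range m, (X - C (b ^ (Fintype.card F ^ i))) := by
    rw [MulSemiringAction.charpoly_eq]
    rw [← Function.Bijective.prod_comp (FiniteField.bijective_frobeniusAlgEquivOfAlgebraic_pow F K)
      (fun g : Gal(K/F) => (X - C (g • b) : K[X]))]
    rw [← hK, Finset.prod_range]
    refine Finset.prod_congr rfl fun i _ => ?_
    congr 2
    rw [AlgEquiv.smul_def, AlgEquiv.coe_pow, FiniteField.coe_frobeniusAlgEquivOfAlgebraic_iterate]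
  rw [← hchar]
  have hmon := MulSemiringAction.monic_charpoly Gal(K/F) b
  obtain ⟨P, hP, hPd, hPm⟩ := lifts_and_natDegree_eq_and_monic
    (Algebra.IsInvariant.charpoly_mem_lifts F K Gal(K/F) b) hmon
  have hdeg : P.natDegree = m := by
    rw [hPd, hchar, natDegree_prod_of_monic _ _ (fun i _ => monic_X_sub_C _)]
    simp only [natDegree_X_sub_C]
    simp
  have hb : IsIntegral F b := Algebra.IsIntegral.isIntegral b
  have hirr := minpoly.irreducible hb
  have hπ := minpoly.monic hb
  have hfac : ∀ p : F[X], Irreducible p → p ∣ P → minpoly F b ∣ p := by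
    intro p hp hpd
    have h1 : (p.map (algebraMap F K)) ∣ ∏ i ∈ Finset.range m, (X - C (b ^ (Fintype.card F ^ i))) := by
      rw [← hchar, ← hP]; exact Polynomial.map_dvd _ hpd
    have hsp : (∏ i ∈ Finset.range m, (X - C (b ^ (Fintype.card F ^ i)))).Splits :=
      Splits.prod fun i _ => Splits.X_sub_C _
    have hne : (∏ i ∈ Finset.range m, (X - C (b ^ (Fintype.card F ^ i))) : K[X]) ≠ 0 :=
      (monic_prod_of_monic _ _ (fun i _ => monic_X_sub_C _)).ne_zero
    have hs2 := hsp.of_dvd hne h1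
    obtain ⟨x, hx⟩ := hs2.exists_eval_eq_zero (by rw [degree_map]; exact (degree_pos_of_irreducible hp).ne')
    have hx2 : (∏ i ∈ Finset.range m, (X - C (b ^ (Fintype.card F ^ i))) : K[X]).eval x = 0 :=
      eval_eq_zero_of_dvd_of_eval_eq_zero h1 hx
    rw [eval_prod, Finset.prod_eq_zero_iff] at hx2
    obtain ⟨i, -, hi⟩ := hx2
    simp only [eval_sub, eval_X, eval_C, sub_eq_zero] at hi
    apply minpoly.dvd
    have h3 : ((FiniteField.frobeniusAlgHom F K) ^ i) b = x := by
      rw [hi, dd_frob]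
    have h4 : aeval (((FiniteField.frobeniusAlgHom F K) ^ i) b) p = 0 := by
      rw [h3, aeval_def, ← eval_map]; exact hx
    rw [aeval_algHom_apply] at h4
    exact (map_eq_zero _).1 h4
  have hfin : FiniteMultiplicity (minpoly F b) P :=
    FiniteMultiplicity.of_prime_left hirr.prime hPm.ne_zero
  obtain ⟨c, hc, hcn⟩ := hfin.exists_eq_pow_mul_and_not_dvd
  have hcm : c.Monic := (hπ.pow _).of_mul_monic_left (hc ▸ hPm)
  have hc1 : c = 1 := by
    by_contra h
    have hu : ¬ IsUnit c := fun hu => h (hcm.eq_one_of_isUnit hu)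
    obtain ⟨p, hp, hpc⟩ := WfDvdMonoid.exists_irreducible_factor hu hcm.ne_zero
    exact hcn ((hfac p hp (hpc.trans (hc ▸ dvd_mul_left _ _))).trans hpc)
  rw [hc1, mul_one] at hc
  have he : m / (minpoly F b).natDegree = multiplicity (minpoly F b) P := by
    rw [← hdeg]; nth_rewrite 1 [hc]
    rw [natDegree_pow, Nat.mul_div_cancel _ hirr.natDegree_pos]
  rw [he, ← hc, hP]

lemma dd_prod (F : Type*) {K : Type*} [Field F] [Fintype F] [Field K] [Algebra F K] (n k : ℕ)
    (a b : K) (ha : a ^ (Fintype.card F ^ n) = a) :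
    ∏ i ∈ Finset.range (n * k), (a - b ^ (Fintype.card F ^ i)) =
      (∏ j ∈ Finset.range n, (a ^ (Fintype.card F ^ (n - j)) - b) ^ (Fintype.card F ^ j)) ^
        (∑ l ∈ Finset.range k, Fintype.card F ^ (n * l)) := by
  have h1 : ∏ j ∈ Finset.range n, (a ^ (Fintype.card F ^ (n - j)) - b) ^ (Fintype.card F ^ j)
      = ∏ j ∈ Finset.range n, (a - b ^ (Fintype.card F ^ j)) := by
    refine Finset.prod_congr rfl fun j hj => ?_
    rw [Finset.mem_range] at hj
    rw [dd_sub, ← pow_mul, ← pow_add, Nat.sub_add_cancel hj.le, ha]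
  rw [h1]
  have ha2 : ∀ l, a ^ (Fintype.card F ^ (n * l)) = a := by
    intro l
    induction l with
    | zero => simp
    | succ l ih => rw [Nat.mul_succ, pow_add, pow_mul, ih, ha]
  induction k with
  | zero => simp
  | succ k ih =>
    rw [Nat.mul_succ, Finset.prod_range_add, ih, Finset.sum_range_succ, pow_add]
    congr 1
    rw [← Finset.prod_pow]
    refine Finset.prod_congr rfl fun j _ => ?_
    rw [dd_sub, ha2, ← pow_mul, ← pow_add, add_comm]

lemma dd_geom (q n k : ℕ) (hq : 1 ≤ q) :
    (q ^ n - 1) * (∑ l ∈ Finset.range k, q ^ (n * l)) + 1 = q ^ (n * k) := by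
  have h1 : 1 ≤ q ^ n := Nat.one_le_pow _ _ hq
  induction k with
  | zero => simp
  | succ k ih =>
    rw [Finset.sum_range_succ, Nat.mul_succ, pow_add, mul_add, add_right_comm, ih]
    obtain ⟨c, hc⟩ := Nat.exists_eq_add_of_le h1
    rw [hc, Nat.add_sub_cancel_left]; ring

lemma dd_distinct {F E : Type*} [Field F] [Fintype F] [Field E] [Fintype E] [Algebra F E]
    (n : ℕ) (α : E) (hα : (minpoly F α).natDegree = n) (j : ℕ) (hj : 0 < j) (hjn : j < n) :
    α ^ (Fintype.card F ^ j) ≠ α := by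
  intro h
  have hfin : Module.finrank F (IntermediateField.adjoin F {α}) = n := by
    rw [IntermediateField.adjoin.finrank (Algebra.IsIntegral.isIntegral α), hα]
  have hone : (FiniteField.frobeniusAlgHom F (IntermediateField.adjoin F {α})) ^ j = 1 := by
    refine IntermediateField.algHom_ext_of_eq_adjoin F (s := {α}) rfl ?_
    intro x hx
    have hx2 : x = α := hx
    subst hx2
    rw [dd_frob]
    ext
    simpa using h
  have := orderOf_dvd_of_pow_eq_one hone
  rw [FiniteField.orderOf_frobeniusAlgHom, hfin] at this
  exact absurd (Nat.le_of_dvd hj this) (by omega)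

open Polynomial

lemma gg_u {F E K : Type*} [Field F] [Fintype F] [Field E] [Fintype E] [Algebra F E]
    [Field K] [Fintype K] [Algebra E K] [Algebra F K] [IsScalarTower F E K]
    (α : E) (m : ℕ) (hK : Module.finrank F K = m) (b : K) :
    algebraMap E K (aeval α (minpoly F b ^ (m / (minpoly F b).natDegree))) =
      ∏ i ∈ Finset.range m, (algebraMap E K α - b ^ (Fintype.card F ^ i)) := by
  rw [← aeval_algebraMap_apply, aeval_def, ← eval_map, dd_min m hK b, eval_prod]
  simp only [eval_sub, eval_X, eval_C]

lemma gg_bound {F E : Type*} [Field F] [Fintype F] [Field E] [Fintype E] [Algebra F E]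
    (n : ℕ) (hn : 1 < n) (hfin : Module.finrank F E = n)
    (α : E) (hα : (minpoly F α).natDegree = n) (χ : MulChar E ℂ) (hχ : χ ≠ 1) :
    ∃ A : ℝ, ∀ k, 1 ≤ k →
      ‖aaS (χ.toMonoidHom.comp (aeval (R := F) α : F[X] →* E)) (n * (2 * k))‖ ≤
        A * ((Fintype.card F : ℝ) ^ n) ^ k := by
  classical
  set q := Fintype.card F with hq
  have hq1 : 1 < q := Fintype.one_lt_card
  set r := q ^ n - 1 with hr
  set D := ∑ j ∈ Finset.range n, q ^ j with hD
  have hcE : Fintype.card E = q ^ n := by rw [Module.card_eq_pow_finrank (K := F), hfin]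
  refine ⟨((1 + r * (4 * D + 10) + D : ℕ) : ℝ), fun k hk => ?_⟩
  obtain ⟨p, hp⟩ := CharP.exists E
  haveI : Fact p.Prime := ⟨CharP.char_is_prime E p⟩
  haveI : NeZero (2 * k) := ⟨by omega⟩
  let K := FiniteField.Extension E p (2 * k)
  letI : Fintype K := Fintype.ofFinite K
  letI : Algebra F K := ((algebraMap E K).comp (algebraMap F E)).toAlgebra
  haveI : IsScalarTower F E K := IsScalarTower.of_algebraMap_eq' rfl
  have hEK : Module.finrank E K = 2 * k := FiniteField.finrank_extension E p (2 * k)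
  have hFK : Module.finrank F K = n * (2 * k) := by
    rw [← Module.finrank_mul_finrank F E K, hfin, hEK]
  rw [aa_S_eq (K := K) (n * (2 * k)) (by positivity) hFK]
  set a := algebraMap E K α with ha
  have haq : a ^ (q ^ n) = a := by
    rw [ha, ← map_pow, ← hcE, FiniteField.pow_card]
  have hne : ∀ j, 0 < j → j < n → a ^ (q ^ (n - j)) - a ≠ 0 := by
    intro j h1 h2 h3
    rw [sub_eq_zero, ha, ← map_pow] at h3
    exact dd_distinct n α hα (n - j) (by omega) (by omega) ((algebraMap E K).injective h3)
  set h1 : K[X] := - ∏ j ∈ Finset.range (n - 1), (C (a ^ (q ^ (n - (j + 1)))) - X) ^ (q ^ (j + 1))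
  set h : K[X] := ∏ j ∈ Finset.range n, (C (a ^ (q ^ (n - j))) - X) ^ (q ^ j)
  have hh : h = (X - C a) * h1 := by
    simp only [h, h1]
    obtain ⟨n', rfl⟩ : ∃ n', n = n' + 1 := ⟨n - 1, by omega⟩
    rw [Finset.prod_range_succ', Nat.add_sub_cancel, Nat.sub_zero, haq]
    ring
  have h10 : h1.eval a ≠ 0 := by
    simp only [h1, eval_neg, eval_prod, eval_pow, eval_sub, eval_C, eval_X, neg_ne_zero]
    refine Finset.prod_ne_zero_iff.2 fun j hj => pow_ne_zero _ (hne _ (by omega) ?_)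
    rw [Finset.mem_range] at hj; omega
  have hdeg : h.natDegree ≤ D := by
    refine (natDegree_prod_le _ _).trans (Finset.sum_le_sum fun j _ => ?_)
    refine natDegree_pow_le.trans ?_
    have : (C (a ^ (q ^ (n - j))) - X : K[X]).natDegree ≤ 1 := by
      refine (natDegree_sub_le _ _).trans ?_
      rw [natDegree_C, natDegree_X]; simp
    calc _ ≤ q ^ j * 1 := Nat.mul_le_mul_left _ this
      _ = _ := mul_one _
  have key := st_charsum (E := E) (K := K) χ hχ h h1 a hh h10 D hdeg r
    (∑ l ∈ Finset.range (2 * k), q ^ (n * l)) (q ^ (n * k))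
    (by have := Nat.one_lt_pow (show n ≠ 0 by omega) hq1; omega)
    (by rw [dd_geom q n _ hq1.le, ← pow_mul]; congr 1; ring)
    (by have := Nat.one_lt_pow (show n ≠ 0 by omega) hq1; omega)
    (by rw [Module.card_eq_pow_finrank (K := F), hFK, ← pow_mul]; congr 1; ring)
    (fun b => aeval α (minpoly F b ^ (n * (2 * k) / (minpoly F b).natDegree)))
    (by
      intro b
      rw [gg_u α _ hFK b, dd_prod F n (2 * k) _ b haq]
      congr 1
      simp only [h, eval_prod, eval_pow, eval_sub, eval_C, eval_X]
      rfl)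
  refine key.trans (le_of_eq ?_)
  rw [← pow_mul]; push_cast; rfl

lemma zz_char {E : Type*} [Field E] [Fintype E] (H : Subgroup Eˣ) (hH : H ≠ ⊤) :
    ∃ χ : MulChar E ℂ, χ ≠ 1 ∧ ∀ u ∈ H, χ (u : E) = 1 := by
  classical
  obtain ⟨x, hx⟩ : ∃ x, x ∉ H := by
    by_contra h
    push Not at h
    exact hH ((Subgroup.eq_top_iff' H).2 h)
  have hx' : (QuotientGroup.mk x : Eˣ ⧸ H) ≠ 1 := fun h => hx ((QuotientGroup.eq_one_iff x).1 h)
  have : NeZero (Monoid.exponent (Eˣ ⧸ H)) := ⟨Monoid.exponent_ne_zero_of_finite⟩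
  have : NeZero ((Monoid.exponent (Eˣ ⧸ H) : ℕ) : ℂ) := ⟨by exact_mod_cast NeZero.ne _⟩
  obtain ⟨φ, hφ⟩ := CommGroup.exists_apply_ne_one_of_hasEnoughRootsOfUnity (Eˣ ⧸ H) ℂ hx'
  refine ⟨MulChar.ofUnitHom (φ.comp (QuotientGroup.mk' H)), ?_, ?_⟩
  · intro h
    apply hφ
    have h2 := congrArg (fun c : MulChar E ℂ => c (x : E)) h
    simp only [MulChar.ofUnitHom_coe, MulChar.one_apply_coe] at h2
    exact Units.ext h2
  · intro u hu
    rw [MulChar.ofUnitHom_coe]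
    have : (QuotientGroup.mk' H) u = 1 := (QuotientGroup.eq_one_iff u).2 hu
    rw [MonoidHom.comp_apply, this, map_one, Units.val_one]

lemma zz_surj {F E : Type*} [Field F] [Field E] [Fintype E] [Algebra F E]
    (n : ℕ) (hfin : Module.finrank F E = n)
    (α : E) (hα : (minpoly F α).natDegree = n) (u : E) :
    ∃ r : F[X], r.degree < n ∧ aeval α r = u := by
  have : Module.Finite F E := Module.finite_of_finrank_pos (by
    rw [hfin, ← hα]; exact minpoly.natDegree_pos (.of_finite F α))
  have hi : IsIntegral F α := Algebra.IsIntegral.isIntegral α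
  have htop : IntermediateField.adjoin F {α} = ⊤ := by
    apply IntermediateField.eq_of_le_of_finrank_eq le_top
    rw [IntermediateField.adjoin.finrank hi, hα, IntermediateField.finrank_top', hfin]
  have hu : u ∈ Algebra.adjoin F {α} := by
    rw [← IntermediateField.adjoin_simple_toSubalgebra_of_isAlgebraic hi.isAlgebraic, htop]
    trivial
  rw [Algebra.adjoin_singleton_eq_range_aeval] at hu
  obtain ⟨g, rfl⟩ := hu
  refine ⟨g %ₘ minpoly F α, ?_, ?_⟩
  · have := degree_modByMonic_lt g (minpoly.monic hi)
    rwa [degree_eq_natDegree (minpoly.ne_zero hi), hα] at this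
  · exact aeval_modByMonic_eq_self_of_root (minpoly.aeval F α)

lemma zz_root {F E : Type*} [Field F] [Fintype F] [Field E] [Fintype E] [Algebra F E]
    (n : ℕ) (hn : 1 < n) (hfin : Module.finrank F E = n)
    (α : E) (hα : (minpoly F α).natDegree = n) (χ : MulChar E ℂ) (hχ : χ ≠ 1) (d : ℕ) (hd : 1 ≤ d) :
    ‖aaS (χ.toMonoidHom.comp (aeval (R := F) α : F[X] →* E)) d‖ ≤
      ((n : ℝ) - 1) * √(Fintype.card F : ℝ) ^ d := by
  classical
  set f := χ.toMonoidHom.comp (aeval (R := F) α : F[X] →* E) with hf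
  obtain ⟨l, hl, hS⟩ := bb_newton n hn.le (aaA f) (aaS f) (aa_zero f)
    (fun k hk => aa_vanish α χ hχ n (zz_surj n hfin α hα) k hk) (aa_rec f)
  obtain ⟨A, hA⟩ := gg_bound n hn hfin α hα χ hχ
  have hq0 : (0 : ℝ) < (Fintype.card F : ℝ) := by exact_mod_cast Fintype.card_pos
  have hSi : ∀ m, 1 ≤ m → aaS f m = - ∑ i : Fin l.length, (l.get i) ^ m := by
    intro m hm
    rw [hS m hm, ← Fin.sum_univ_fun_getElem]
    rfl
  have hw : ∀ i : Fin l.length, ‖l.get i‖ ≤ √(Fintype.card F : ℝ) := by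
    intro i
    have h1 := bb_root (fun i : Fin l.length => (l.get i) ^ (2 * n)) A
      ((Fintype.card F : ℝ) ^ n) (by positivity) (fun k hk => by
        have h2 := hA k hk
        rw [hSi _ (by nlinarith), norm_neg] at h2
        have h3 : ∀ j : Fin l.length, (l.get j ^ (2 * n)) ^ k = l.get j ^ (n * (2 * k)) := by
          intro j; rw [← pow_mul]; congr 1; ring
        simp only [h3]
        exact h2) i
    rw [norm_pow] at h1
    apply Real.le_sqrt_of_sq_le
    rw [pow_mul] at h1
    exact le_of_pow_le_pow_left₀ (by omega) hq0.le h1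
  rw [hSi d hd, norm_neg]
  have hln : (l.length : ℝ) ≤ (n : ℝ) - 1 := by
    have : l.length + 1 ≤ n := by omega
    have : (l.length : ℝ) + 1 ≤ n := by exact_mod_cast this
    linarith
  calc _ ≤ ∑ i : Fin l.length, ‖(l.get i) ^ d‖ := norm_sum_le _ _
    _ ≤ ∑ i : Fin l.length, √(Fintype.card F : ℝ) ^ d := by
      refine Finset.sum_le_sum fun i _ => ?_
      rw [norm_pow]
      exact pow_le_pow_left₀ (norm_nonneg _) (hw i) d
    _ = l.length * √(Fintype.card F : ℝ) ^ d := by simp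
    _ ≤ _ := by gcongr

lemma zz_full {F E : Type*} [Field F] [Fintype F] [Field E] [Fintype E] [Algebra F E]
    (n d : ℕ) (hd : 1 ≤ d) (hdn : d < n) (α : E) (hα : (minpoly F α).natDegree = n)
    (χ : MulChar E ℂ)
    (h : ∀ u ∈ Subgroup.closure {u : Eˣ | ∃ g ∈ primarySet F d, (u : E) = Polynomial.aeval α g},
      χ (u : E) = 1) :
    aaS (χ.toMonoidHom.comp (aeval (R := F) α : F[X] →* E)) d = (Fintype.card F : ℂ) ^ d := by
  classical
  obtain ⟨p, hp⟩ := CharP.exists F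
  have : Fact p.Prime := ⟨CharP.char_is_prime F p⟩
  have : NeZero d := ⟨by omega⟩
  let K := FiniteField.Extension F p d
  letI : Fintype K := Fintype.ofFinite K
  have hK : Module.finrank F K = d := FiniteField.finrank_extension F p d
  rw [aa_S_eq (K := K) d hd hK]
  have h1 : ∀ b : K, (χ.toMonoidHom.comp (aeval (R := F) α : F[X] →* E))
      (minpoly F b ^ (d / (minpoly F b).natDegree)) = 1 := by
    intro b
    have hb : IsIntegral F b := Algebra.IsIntegral.isIntegral b
    have hdvd : (minpoly F b).natDegree ∣ d := by
      have h0 := minpoly.degree_dvd hb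
      rwa [hK] at h0
    have hpos := minpoly.natDegree_pos hb
    set g := minpoly F b ^ (d / (minpoly F b).natDegree) with hg
    have hgm : g.Monic := (minpoly.monic hb).pow _
    have hgd : g.natDegree = d := by
      rw [hg, natDegree_pow, Nat.div_mul_cancel hdvd]
    have hmem : g ∈ primarySet F d := ⟨hgm, hgd, minpoly F b, minpoly.monic hb,
      minpoly.irreducible hb, _, Nat.div_pos (Nat.le_of_dvd hd hdvd) hpos, rfl⟩
    have hne : aeval α g ≠ 0 := by
      intro h0
      have := natDegree_le_of_dvd (minpoly.dvd F α h0) hgm.ne_zero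
      omega
    exact h (Units.mk0 _ hne) (Subgroup.subset_closure ⟨g, hmem, rfl⟩)
  rw [Finset.sum_congr rfl fun b _ => h1 b]
  rw [Finset.sum_const, Finset.card_univ, Module.card_eq_pow_finrank (K := F), hK]
  simp

/-- If `n < q^{d/2} + 1` then the subgroup of `𝔽_{q^n}^×` generated by
`E_d = {g(α) : g ∈ P_d}` is all of `𝔽_{q^n}^×`, i.e. `G_d(n,q,α)` is connected. -/
theorem connected_of_small_n
    {F E : Type*} [Field F] [Fintype F] [Field E] [Fintype E] [Algebra F E]
    (q n d : ℕ) (hq : IsPrimePow q)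
    (hcardF : Fintype.card F = q) (hcardE : Fintype.card E = q ^ n)
    (hn : 1 < n) (hd : 1 ≤ d) (hdn : d < n)
    (hcond : (n : ℝ) < (q : ℝ) ^ ((d : ℝ) / 2) + 1)
    (α : E) (hα : (minpoly F α).natDegree = n) :
    Subgroup.closure {u : Eˣ | ∃ g ∈ primarySet F d, (u : E) = Polynomial.aeval α g} = ⊤ := by
  by_contra hH
  obtain ⟨χ, hχ, hone⟩ := zz_char _ hH
  have hfin : Module.finrank F E = n := by
    have h1 := Module.card_eq_pow_finrank (K := F) (V := E)
    rw [hcardE, hcardF] at h1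
    exact (Nat.pow_right_injective hq.two_le h1).symm
  have h1 := zz_root n hn hfin α hα χ hχ d hd
  rw [zz_full n d hd hdn α hα χ hone, hcardF, norm_pow, Complex.norm_natCast] at h1
  have hq0 : (0 : ℝ) < q := by exact_mod_cast hq.pos
  have h2 : (q : ℝ) ^ ((d : ℝ) / 2) = √(q : ℝ) ^ d := by
    rw [Real.sqrt_eq_rpow, ← Real.rpow_natCast, ← Real.rpow_mul hq0.le]
    congr 1; ring
  have h3 : (q : ℝ) ^ d = √(q : ℝ) ^ d * √(q : ℝ) ^ d := by
    rw [← mul_pow, Real.mul_self_sqrt hq0.le]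
  have h4 : 0 < √(q : ℝ) ^ d := by positivity
  rw [h3] at h1
  have h5 := le_of_mul_le_mul_right h1 h4
  rw [h2] at hcond
  linarith
end

section
/- Let q be a prime power, n > 1 and 1 ≤ d < n integers with n < q^{d/2} + 1, and let α ∈ 𝔽_{q^n} have degree n over 𝔽_q. Then for every β ∈ 𝔽_{q^n}^× there exist a positive integer k with k ≤ 2·(n/d) + 1 + (4·(n/d)·log(n−1)) / (d·log q − 2·log(n−1)) and primary polynomials g₁, …, g_k ∈ P_d such that β = g₁(α)···g_k(α); that is, the diameter D of the Cayley graph G_d(n,q,α) satisfies D ≤ 2(n/d) + 1 + 4(n/d)log(n−1)/(d log q − 2 log(n−1)). -/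
open Polynomial

theorem dbA_powersums (N : ℕ) (c S : ℕ → ℂ) (h0 : c 0 = 1) (hN : ∀ r, N < r → c r = 0)
    (hrec : ∀ r : ℕ, 1 ≤ r → (r : ℂ) * c r =
      ∑ a ∈ Finset.HasAntidiagonal.antidiagonal r with a.1 < r, c a.1 * S a.2) :
    ∃ γ : Fin N → ℂ, ∀ r, 1 ≤ r → S r = - ∑ i, γ i ^ r := by
  classical
  let R : ℂ[X] := ∑ k ∈ Finset.range (N + 1), C (c k) * X ^ (N - k)
  have hcoeff : ∀ k ≤ N, R.coeff (N - k) = c k := by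
    intro k hk
    simp only [R, finsetSum_coeff, coeff_C_mul, coeff_X_pow]
    rw [Finset.sum_eq_single k]
    · simp
    · intro b hb hbk
      rw [if_neg]; · simp
      simp at hb; omega
    · intro h; simp at h; omega
  have hdeg : R.natDegree ≤ N := by
    apply natDegree_sum_le_of_forall_le
    intro k _
    exact (natDegree_C_mul_X_pow_le _ _).trans (Nat.sub_le _ _)
  have hlead : R.coeff N = 1 := by simpa [h0] using hcoeff 0 (Nat.zero_le _)
  have hmonic : R.Monic := monic_of_natDegree_le_of_coeff_eq_one N hdeg hlead
  have hnd : R.natDegree = N := natDegree_eq_of_le_of_coeff_ne_zero hdeg (by simp [hlead])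
  have hcard : Multiset.card R.roots = R.natDegree := (IsAlgClosed.splits R).natDegree_eq_card_roots.symm
  obtain ⟨γ, hγ⟩ : ∃ γ : Fin N → ℂ, Finset.univ.val.map γ = R.roots := by
    obtain ⟨l, hl⟩ := Quot.exists_rep R.roots
    have hll : l.length = N := by
      rw [← hnd, ← hcard, ← hl]; rfl
    subst hll
    refine ⟨l.get, ?_⟩
    rw [Fin.univ_val_map, List.ofFn_get, ← hl]; rfl
  let e : ℕ → ℂ := fun r => R.roots.esymm r
  have hc : ∀ r, c r = (-1) ^ r * e r := by
    intro r
    rcases le_or_gt r N with hr | hr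
    · have := coeff_eq_esymm_roots_of_card hcard (k := N - r) (by omega)
      rw [hcoeff r hr, hmonic.leadingCoeff, hnd, one_mul, Nat.sub_sub_self hr] at this
      exact this
    · rw [hN r hr]
      simp only [e, Multiset.esymm]
      rw [Multiset.powersetCard_eq_empty]
      · simp
      · omega
  have he : ∀ r, MvPolynomial.aeval γ (MvPolynomial.esymm (Fin N) ℂ r) = e r := by
    intro r
    rw [MvPolynomial.aeval_esymm_eq_multiset_esymm, hγ]
  have hp : ∀ r, MvPolynomial.aeval γ (MvPolynomial.psum (Fin N) ℂ r) = ∑ i, γ i ^ r := by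
    intro r; simp [MvPolynomial.psum]
  have hnewton : ∀ r : ℕ, (r : ℂ) * c r =
      - ∑ a ∈ Finset.HasAntidiagonal.antidiagonal r with a.1 < r, c a.1 * (∑ i, γ i ^ a.2) := by
    intro r
    have := congrArg (MvPolynomial.aeval γ) (MvPolynomial.mul_esymm_eq_sum (Fin N) ℂ r)
    simp only [map_mul, map_sum, map_pow, map_neg, map_one, map_natCast, he, hp] at this
    rw [hc r, mul_left_comm, this, ← mul_assoc, ← pow_add, show r + (r + 1) = 2 * r + 1 by ring,
      pow_succ, pow_mul]
    simp [hc]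
  refine ⟨γ, ?_⟩
  intro r
  induction r using Nat.strong_induction_on with
  | _ r ih =>
    intro hr
    have h1 := (hrec r hr).symm.trans (hnewton r)
    rw [← sub_eq_zero, sub_neg_eq_add, ← Finset.sum_add_distrib] at h1
    rw [Finset.sum_eq_single (0, r)] at h1
    · simp [h0] at h1
      exact eq_neg_of_add_eq_zero_left h1
    · rintro ⟨a, b⟩ hab hne
      simp at hab hne
      have : b < r := by
        rcases Nat.eq_zero_or_pos a with h | h
        · exact absurd (by omega) (hne h)
        · omega
      simp only
      rw [ih b this (by omega)]; ring
    · intro h; exfalso; apply h; simp; omega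

theorem dbA_root_bound (N : ℕ) (γ : Fin N → ℂ) (B C : ℝ) (hB : 0 < B) (t s0 : ℕ) (ht : 1 ≤ t)
    (h : ∀ s, s0 ≤ s → ‖∑ i, γ i ^ (t * s)‖ ≤ C * B ^ (t * s)) (i : Fin N) : ‖γ i‖ ≤ B := by
  classical
  by_contra! hlt
  let δ : Fin N → ℂ := fun i => γ i ^ t
  let T : Finset ℂ := (Finset.univ.image δ).erase (δ i)
  let P : ℂ[X] := ∏ z ∈ T, (X - Polynomial.C z)
  have hPi : P.eval (δ i) ≠ 0 := by
    simp only [P, eval_prod, eval_sub, eval_X, eval_C]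
    rw [Finset.prod_ne_zero_iff]
    intro z hz
    exact sub_ne_zero.mpr (Finset.ne_of_mem_erase hz).symm
  have hPj : ∀ j, δ j ≠ δ i → P.eval (δ j) = 0 := by
    intro j hj
    simp only [P, eval_prod, eval_sub, eval_X, eval_C]
    apply Finset.prod_eq_zero (i := δ j)
    · simp [T, hj]
    · simp
  let M := (Finset.univ.filter (fun j => δ j = δ i)).card
  have hM : 1 ≤ M := Finset.card_pos.mpr ⟨i, by simp⟩
  have key : ∀ s, ∑ k ∈ Finset.range (P.natDegree + 1), P.coeff k * ∑ j, γ j ^ (t * (s + k))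
      = M * P.eval (δ i) * δ i ^ s := by
    intro s
    have : ∀ j, ∑ k ∈ Finset.range (P.natDegree + 1), P.coeff k * γ j ^ (t * (s + k))
        = if δ j = δ i then P.eval (δ i) * δ i ^ s else 0 := by
      intro j
      have h2 : ∑ k ∈ Finset.range (P.natDegree + 1), P.coeff k * γ j ^ (t * (s + k))
        = P.eval (δ j) * δ j ^ s := by
        rw [eval_eq_sum_range, Finset.sum_mul]
        refine Finset.sum_congr rfl fun k _ => ?_
        simp only [δ]; rw [pow_mul, pow_add]; ring
      rw [h2]
      split_ifs with h3
      · rw [h3]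
      · rw [hPj j h3, zero_mul]
    simp_rw [Finset.mul_sum]
    rw [Finset.sum_comm]
    simp_rw [this]
    rw [← Finset.sum_filter, Finset.sum_const, nsmul_eq_mul, mul_assoc]
  let D : ℝ := ∑ k ∈ Finset.range (P.natDegree + 1), ‖P.coeff k‖ * (C * B ^ (t * k))
  have bound : ∀ s, s0 ≤ s → ‖P.eval (δ i)‖ * (‖γ i‖ ^ t) ^ s ≤ D * (B ^ t) ^ s := by
    intro s hs
    have h1 : ‖(M : ℂ) * P.eval (δ i) * δ i ^ s‖ ≤ D * (B ^ t) ^ s := by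
      rw [← key s]
      refine (norm_sum_le _ _).trans ?_
      simp only [D]
      rw [Finset.sum_mul]
      refine Finset.sum_le_sum fun k _ => ?_
      rw [norm_mul, mul_assoc]
      refine mul_le_mul_of_nonneg_left ((h (s + k) (by omega)).trans (le_of_eq ?_)) (norm_nonneg _)
      rw [mul_assoc, ← pow_mul, ← pow_add]; ring_nf
    refine le_trans ?_ h1
    rw [norm_mul, norm_mul, norm_pow, Complex.norm_natCast]
    simp only [δ, norm_pow]
    have : (1:ℝ) ≤ M := by exact_mod_cast hM
    have h4 : 0 ≤ ‖P.eval (γ i ^ t)‖ * (‖γ i‖ ^ t) ^ s := by positivity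
    nlinarith
  have hr : 1 < ‖γ i‖ ^ t / B ^ t := by
    rw [one_lt_div (by positivity)]
    exact pow_lt_pow_left₀ hlt hB.le (by omega)
  have hpos : 0 < ‖P.eval (δ i)‖ := norm_pos_iff.mpr hPi
  obtain ⟨s, hs⟩ := ((tendsto_pow_atTop_atTop_of_one_lt hr).eventually_gt_atTop
    (D / ‖P.eval (δ i)‖)).and (Filter.eventually_ge_atTop s0) |>.exists
  have h5 := bound s hs.2
  have h6 := hs.1
  rw [div_pow, div_lt_div_iff₀ hpos (by positivity)] at h6
  linarith

theorem dbA_final (N : ℕ) (c S : ℕ → ℂ) (h0 : c 0 = 1) (hN : ∀ r, N < r → c r = 0)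
    (hrec : ∀ r : ℕ, 1 ≤ r → (r : ℂ) * c r =
      ∑ a ∈ Finset.HasAntidiagonal.antidiagonal r with a.1 < r, c a.1 * S a.2)
    (B C : ℝ) (hB : 0 < B) (t s0 : ℕ) (ht : 1 ≤ t)
    (h : ∀ s, s0 ≤ s → ‖S (t * s)‖ ≤ C * B ^ (t * s)) (d : ℕ) (hd : 1 ≤ d) :
    ‖S d‖ ≤ N * B ^ d := by
  obtain ⟨γ, hγ⟩ := dbA_powersums N c S h0 hN hrec
  have hb : ∀ i, ‖γ i‖ ≤ B := by
    refine dbA_root_bound N γ B C hB t (s0 + 1) ht ?_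
    intro s hs
    rw [← norm_neg, ← hγ (t * s) (Nat.mul_pos ht (by omega))]
    exact h s (by omega)
  rw [hγ d hd, norm_neg]
  refine (norm_sum_le _ _).trans ?_
  refine (Finset.sum_le_sum (g := fun _ => B ^ d) fun i _ => ?_).trans (by simp)
  rw [norm_pow]
  exact pow_le_pow_left₀ (norm_nonneg _) (hb i) d

theorem dbB_monic_finite (F : Type*) [Field F] [Finite F] (r : ℕ) :
    {f : F[X] | f.Monic ∧ f.natDegree = r}.Finite := by
  apply Set.Finite.of_finite_image (f := fun f : F[X] => fun i : Fin (r + 1) => f.coeff i)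
    (Set.toFinite _)
  rintro f ⟨_, hf⟩ g ⟨_, hg⟩ h
  ext k
  rcases Nat.lt_or_ge k (r + 1) with hk | hk
  · exact congrFun h ⟨k, hk⟩
  · rw [coeff_eq_zero_of_natDegree_lt (by omega), coeff_eq_zero_of_natDegree_lt (by omega)]

/-- monic polynomials of degree `r` -/
noncomputable def dbMon (F : Type*) [Field F] [Finite F] (r : ℕ) : Finset F[X] :=
  (dbB_monic_finite F r).toFinset

theorem mem_dbMon {F : Type*} [Field F] [Finite F] {r : ℕ} {f : F[X]} :
    f ∈ dbMon F r ↔ f.Monic ∧ f.natDegree = r := by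
  simp [dbMon]

open Classical in
/-- monic irreducible polynomials of degree at most `r` -/
noncomputable def dbIrr (F : Type*) [Field F] [Finite F] (r : ℕ) : Finset F[X] :=
  ((Finset.range (r + 1)).biUnion (dbMon F)).filter Irreducible

theorem mem_dbIrr {F : Type*} [Field F] [Finite F] {r : ℕ} {f : F[X]} :
    f ∈ dbIrr F r ↔ f.Monic ∧ Irreducible f ∧ f.natDegree ≤ r := by
  simp only [dbIrr, Finset.mem_filter, Finset.mem_biUnion, Finset.mem_range, mem_dbMon]
  constructor
  · rintro ⟨⟨a, ha, h1, h2⟩, h3⟩; exact ⟨h1, h3, by omega⟩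
  · rintro ⟨h1, h2, h3⟩; exact ⟨⟨_, by omega, h1, rfl⟩, h2⟩

/-- coefficient of the `L`-function -/
noncomputable def dbC {F : Type*} [Field F] [Finite F] (φ : F[X] →* ℂ) (r : ℕ) : ℂ :=
  ∑ f ∈ dbMon F r, φ f

/-- von Mangoldt type sum -/
noncomputable def dbPsi {F : Type*} [Field F] [Finite F] (φ : F[X] →* ℂ) (j : ℕ) : ℂ :=
  ∑ p ∈ dbIrr F j with p.natDegree ∣ j, (p.natDegree : ℂ) * φ p ^ (j / p.natDegree)

open Classical in
theorem dbB_degree {F : Type*} [Field F] [Finite F] {r : ℕ} {f : F[X]} (hf : f ∈ dbMon F r) :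
    r = ∑ p ∈ dbIrr F r, ∑ e ∈ Finset.Icc 1 r, if p ^ e ∣ f then p.natDegree else 0 := by
  obtain ⟨hm, hr⟩ := mem_dbMon.mp hf
  have hf0 : f ≠ 0 := hm.ne_zero
  have hfac : ∀ p ∈ UniqueFactorizationMonoid.normalizedFactors f, p ∈ dbIrr F r := by
    intro p hp
    have hirr := UniqueFactorizationMonoid.irreducible_of_normalized_factor p hp
    refine mem_dbIrr.mpr ⟨?_, hirr, ?_⟩
    · rw [← UniqueFactorizationMonoid.normalize_normalized_factor p hp]
      exact monic_normalize hirr.ne_zero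
    · rw [← hr]
      exact natDegree_le_of_dvd (UniqueFactorizationMonoid.dvd_of_mem_normalizedFactors hp) hf0
  have h1 : f = (UniqueFactorizationMonoid.normalizedFactors f).prod := by
    have := UniqueFactorizationMonoid.prod_normalizedFactors_eq hf0
    rw [this, hm.normalize_eq_self]
  have h2 : r = ((UniqueFactorizationMonoid.normalizedFactors f).map natDegree).sum := by
    conv_lhs => rw [← hr, h1]
    apply natDegree_multiset_prod
    exact UniqueFactorizationMonoid.zero_notMem_normalizedFactors f
  have h3 : r = ∑ p ∈ dbIrr F r,
      (UniqueFactorizationMonoid.normalizedFactors f).count p * p.natDegree := by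
    conv_lhs => rw [h2, Finset.sum_multiset_map_count]
    simp only [smul_eq_mul]
    apply Finset.sum_subset
    · intro p hp; exact hfac p (Multiset.mem_toFinset.mp hp)
    · intro p _ hp
      rw [Multiset.count_eq_zero_of_notMem (fun h => hp (Multiset.mem_toFinset.mpr h)), zero_mul]
  conv_lhs => rw [h3]
  refine Finset.sum_congr rfl fun p hp => ?_
  obtain ⟨pm, pirr, pd⟩ := mem_dbIrr.mp hp
  rw [← Finset.sum_filter, Finset.sum_const, smul_eq_mul]
  congr 1
  have hiff : ∀ e, p ^ e ∣ f ↔ e ≤ (UniqueFactorizationMonoid.normalizedFactors f).count p := by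
    intro e
    rw [pow_dvd_iff_le_emultiplicity,
      UniqueFactorizationMonoid.emultiplicity_eq_count_normalizedFactors pirr hf0,
      pm.normalize_eq_self]
    simp
  have hle : (UniqueFactorizationMonoid.normalizedFactors f).count p ≤ r := by
    have h4 := natDegree_le_of_dvd ((hiff _).mpr le_rfl) hf0
    rw [natDegree_pow, hr] at h4
    have := pirr.natDegree_pos
    nlinarith
  have : (Finset.Icc 1 r).filter (fun e => p ^ e ∣ f) =
      Finset.Icc 1 ((UniqueFactorizationMonoid.normalizedFactors f).count p) := by
    ext e; simp only [Finset.mem_filter, Finset.mem_Icc, hiff]; omega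
  rw [this]; simp

open Classical in
theorem dbB_mult {F : Type*} [Field F] [Finite F] (φ : F[X] →* ℂ) (r : ℕ) (g : F[X])
    (hg : g.Monic) :
    ∑ f ∈ dbMon F r with g ∣ f, φ f =
      if g.natDegree ≤ r then φ g * dbC φ (r - g.natDegree) else 0 := by
  split_ifs with h
  · rw [dbC, Finset.mul_sum]
    symm
    refine Finset.sum_bij (fun f _ => g * f) ?_ ?_ ?_ ?_
    · intro f hf
      obtain ⟨h1, h2⟩ := mem_dbMon.mp hf
      simp only [Finset.mem_filter, mem_dbMon, dvd_mul_right, and_true]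
      exact ⟨hg.mul h1, by rw [hg.natDegree_mul h1]; omega⟩
    · intro a _ b _ hab
      exact mul_left_cancel₀ hg.ne_zero hab
    · intro f hf
      simp only [Finset.mem_filter, mem_dbMon] at hf
      obtain ⟨⟨h1, h2⟩, k, rfl⟩ := hf
      have hk : k.Monic := hg.of_mul_monic_left h1
      refine ⟨k, mem_dbMon.mpr ⟨hk, ?_⟩, rfl⟩
      rw [hg.natDegree_mul hk] at h2; omega
    · intro f _; rw [map_mul]
  · apply Finset.sum_eq_zero
    intro f hf
    simp only [Finset.mem_filter, mem_dbMon] at hf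
    exact absurd (hf.1.2 ▸ natDegree_le_of_dvd hf.2 hf.1.1.ne_zero) h

open Classical in
theorem dbB_newton {F : Type*} [Field F] [Finite F] (φ : F[X] →* ℂ) (r : ℕ) :
    (r : ℂ) * dbC φ r = ∑ a ∈ Finset.HasAntidiagonal.antidiagonal r with a.1 < r,
      dbC φ a.1 * dbPsi φ a.2 := by
  have L : (r : ℂ) * dbC φ r = ∑ p ∈ dbIrr F r, ∑ e ∈ Finset.Icc 1 r,
      (p.natDegree : ℂ) *
        (if e * p.natDegree ≤ r then φ p ^ e * dbC φ (r - e * p.natDegree) else 0) := by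
    have h1 : (r : ℂ) * dbC φ r = ∑ f ∈ dbMon F r, ∑ p ∈ dbIrr F r, ∑ e ∈ Finset.Icc 1 r,
        (p.natDegree : ℂ) * (if p ^ e ∣ f then φ f else 0) := by
      rw [dbC, Finset.mul_sum]
      refine Finset.sum_congr rfl fun f hf => ?_
      conv_lhs => rw [dbB_degree hf]
      push_cast
      rw [Finset.sum_mul]
      refine Finset.sum_congr rfl fun p _ => ?_
      rw [Finset.sum_mul]
      refine Finset.sum_congr rfl fun e _ => ?_
      split_ifs <;> simp
    rw [h1, Finset.sum_comm]
    refine Finset.sum_congr rfl fun p hp => ?_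
    rw [Finset.sum_comm]
    refine Finset.sum_congr rfl fun e _ => ?_
    rw [← Finset.mul_sum, ← Finset.sum_filter]
    rw [dbB_mult φ r (p ^ e) ((mem_dbIrr.mp hp).1.pow e), natDegree_pow, map_pow]
  rw [L]
  have R : ∀ a ∈ (Finset.HasAntidiagonal.antidiagonal r).filter (fun a => a.1 < r),
      dbC φ a.1 * dbPsi φ a.2 = ∑ p ∈ dbIrr F r, if p.natDegree ∣ a.2 then
        dbC φ a.1 * ((p.natDegree : ℂ) * φ p ^ (a.2 / p.natDegree)) else 0 := by
    intro a ha
    simp only [Finset.mem_filter, Finset.HasAntidiagonal.mem_antidiagonal] at ha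
    rw [← Finset.sum_filter, dbPsi, Finset.mul_sum]
    refine Finset.sum_congr ?_ fun _ _ => rfl
    ext p
    simp only [Finset.mem_filter, mem_dbIrr]
    constructor
    · rintro ⟨⟨h1, h2, h3⟩, h4⟩; exact ⟨⟨h1, h2, by omega⟩, h4⟩
    · rintro ⟨⟨h1, h2, h3⟩, h4⟩
      exact ⟨⟨h1, h2, Nat.le_of_dvd (by omega) h4⟩, h4⟩
  conv_rhs => rw [Finset.sum_congr rfl R, Finset.sum_comm]
  refine Finset.sum_congr rfl fun p hp => ?_
  have hpos : 0 < p.natDegree := (mem_dbIrr.mp hp).2.1.natDegree_pos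
  simp only [mul_ite, mul_zero]
  rw [← Finset.sum_filter, ← Finset.sum_filter]
  refine Finset.sum_bij' (fun e _ => (r - e * p.natDegree, e * p.natDegree))
    (fun a _ => a.2 / p.natDegree) ?_ ?_ ?_ ?_ ?_
  · intro e he
    simp only [Finset.mem_filter, Finset.mem_Icc, Finset.HasAntidiagonal.mem_antidiagonal] at he ⊢
    have : 0 < e * p.natDegree := Nat.mul_pos (by omega) hpos
    exact ⟨⟨by omega, by omega⟩, dvd_mul_left _ _⟩
  · rintro ⟨a, b⟩ hab
    simp only [Finset.mem_filter, Finset.mem_Icc, Finset.HasAntidiagonal.mem_antidiagonal] at hab ⊢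
    obtain ⟨⟨h1, h2⟩, k, rfl⟩ := hab
    rw [Nat.mul_div_cancel_left _ hpos]
    have : k ≠ 0 := by rintro rfl; simp at h1; omega
    refine ⟨⟨by omega, ?_⟩, ?_⟩
    · nlinarith
    · rw [mul_comm]; omega
  · intro e _; exact Nat.mul_div_cancel _ hpos
  · rintro ⟨a, b⟩ hab
    simp only [Finset.mem_filter, Finset.HasAntidiagonal.mem_antidiagonal] at hab
    obtain ⟨⟨h1, h2⟩, k, rfl⟩ := hab
    simp only [Nat.mul_div_cancel_left _ hpos, mul_comm k, Prod.mk.injEq, and_true]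
    omega
  · intro e _
    simp only [Nat.mul_div_cancel _ hpos]; ring

/-- The sum over an extension field. -/
theorem dbB_psi_eq {F : Type*} [Field F] [Finite F] (φ : F[X] →* ℂ) (j : ℕ) (hj : 1 ≤ j)
    (K : Type*) [Field K] [Fintype K] [Algebra F K] (hK : Module.finrank F K = j) :
    dbPsi φ j = ∑ x : K, φ (minpoly F x ^ (j / (minpoly F x).natDegree)) := by
  classical
  have hfin : FiniteDimensional F K := Module.Finite.of_finite
  have hint : ∀ x : K, IsIntegral F x := fun x => Algebra.IsIntegral.isIntegral x
  have hdvd : ∀ x : K, (minpoly F x).natDegree ∣ j := fun x => hK ▸ minpoly.degree_dvd (hint x)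
  have hmaps : ∀ x ∈ (Finset.univ : Finset K),
      minpoly F x ∈ (dbIrr F j).filter (fun p => p.natDegree ∣ j) := by
    intro x _
    rw [Finset.mem_filter, mem_dbIrr]
    exact ⟨⟨minpoly.monic (hint x), minpoly.irreducible (hint x), Nat.le_of_dvd hj (hdvd x)⟩,
      hdvd x⟩
  rw [← Finset.sum_fiberwise_of_maps_to hmaps, dbPsi]
  refine Finset.sum_congr rfl fun p hp => ?_
  simp only [Finset.mem_filter, mem_dbIrr] at hp
  obtain ⟨⟨pm, pirr, _⟩, pd⟩ := hp
  have : ∀ x ∈ (Finset.univ : Finset K).filter (fun x => minpoly F x = p),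
      φ (minpoly F x ^ (j / (minpoly F x).natDegree)) = φ p ^ (j / p.natDegree) := by
    intro x hx
    simp only [Finset.mem_filter] at hx
    rw [hx.2, map_pow]
  rw [Finset.sum_congr rfl this, Finset.sum_const, nsmul_eq_mul]
  congr 2
  have hd : p ∣ X ^ (Nat.card F) ^ j - X :=
    (pirr.natDegree_dvd_iff_dvd_X_pow_card_pow_sub_X).mp pd
  have hcK : Fintype.card K = Nat.card F ^ j := by
    rw [← Nat.card_eq_fintype_card, ← hK, Module.natCard_eq_pow_finrank (K := F)]
  have hsp : (p.map (algebraMap F K)).Splits := by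
    have h1 : (X ^ Fintype.card K - X : K[X]).Splits := by
      rw [splits_iff_card_roots, FiniteField.roots_X_pow_card_sub_X,
        FiniteField.X_pow_card_sub_X_natDegree_eq K Fintype.one_lt_card]
      rfl
    refine h1.of_dvd (FiniteField.X_pow_card_sub_X_ne_zero K Fintype.one_lt_card) ?_
    have := map_dvd (mapRingHom (algebraMap F K)) hd
    simpa [hcK] using this
  have hsep : p.Separable := PerfectField.separable_of_irreducible pirr
  rw [← card_rootSet_eq_natDegree hsep hsp, Fintype.card_subtype]
  congr 1
  ext x
  simp only [Finset.mem_filter, Finset.mem_univ, true_and, mem_rootSet]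
  constructor
  · rintro ⟨_, hx⟩
    exact (minpoly.eq_of_irreducible_of_monic pirr hx pm).symm
  · rintro rfl
    exact ⟨pm.ne_zero, minpoly.aeval F x⟩

theorem dbD_nonvanish {K : Type*} [Field K] (α : K) (f1 : K[X]) (hf1 : f1.eval α ≠ 0)
    (I m A L : ℕ) (hL : m * A < L) (k : Fin I × Fin m → K[X])
    (hk : ∀ u, (k u).degree < A)
    (h0 : ∑ u, k u * (X - C α) ^ (u.1.1 * L) * ((X - C α) * f1) ^ (u.2.1 * A) = 0) :
    ∀ u, k u = 0 := by
  classical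
  by_contra! hne
  let v : Fin I × Fin m → ℕ := fun u => u.1.1 * L + u.2.1 * A
  obtain ⟨w, hw, hmin⟩ := Finset.exists_min_image
    ((Finset.univ : Finset (Fin I × Fin m)).filter (fun u => k u ≠ 0)) v
    (by obtain ⟨u, hu⟩ := hne; exact ⟨u, by simpa using hu⟩)
  simp only [Finset.mem_filter, Finset.mem_univ, true_and] at hw hmin
  have hsep : ∀ u, k u ≠ 0 → u ≠ w → v w + A ≤ v u := by
    intro u hu huw
    have h1 := hmin u hu
    obtain ⟨⟨a, ha⟩, ⟨b, hb⟩⟩ := u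
    obtain ⟨⟨c, hc⟩, ⟨d, hd⟩⟩ := w
    simp only [v] at h1 ⊢
    have e1 : (b + 1) * A ≤ m * A := Nat.mul_le_mul_right _ hb
    have e2 : (d + 1) * A ≤ m * A := Nat.mul_le_mul_right _ hd
    rw [add_mul] at e1 e2
    rcases lt_trichotomy a c with h | h | h
    · have : (a + 1) * L ≤ c * L := Nat.mul_le_mul_right _ h
      rw [add_mul] at this
      omega
    · subst h
      rcases lt_trichotomy b d with h' | h' | h'
      · have : (b + 1) * A ≤ d * A := Nat.mul_le_mul_right _ h'
        rw [add_mul] at this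
        omega
      · subst h'; exact absurd rfl huw
      · have : (d + 1) * A ≤ b * A := Nat.mul_le_mul_right _ h'
        rw [add_mul] at this
        omega
    · have : (c + 1) * L ≤ a * L := Nat.mul_le_mul_right _ h
      rw [add_mul] at this
      omega
  have hterm : ∀ u, k u * (X - C α) ^ (u.1.1 * L) * ((X - C α) * f1) ^ (u.2.1 * A)
      = (X - C α) ^ v u * (k u * f1 ^ (u.2.1 * A)) := by
    intro u; simp only [v]; rw [mul_pow, pow_add]; ring
  have hdvd : (X - C α) ^ (v w + A) ∣ (X - C α) ^ v w * (k w * f1 ^ (w.2.1 * A)) := by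
    have h1 := h0
    rw [← Finset.add_sum_erase _ _ (Finset.mem_univ w), hterm w] at h1
    rw [eq_neg_of_add_eq_zero_left h1, dvd_neg]
    refine Finset.dvd_sum fun u hu => ?_
    rw [hterm u]
    by_cases hku : k u = 0
    · simp [hku]
    · exact Dvd.dvd.mul_right (pow_dvd_pow _ (hsep u hku (Finset.ne_of_mem_erase hu))) _
  rw [pow_add] at hdvd
  have hx : (X - C α) ^ v w ≠ 0 := pow_ne_zero _ (X_sub_C_ne_zero α)
  have hd2 := (mul_dvd_mul_iff_left hx).mp hdvd
  have hcop : IsCoprime ((X - C α) ^ A) (f1 ^ (w.2.1 * A)) := by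
    apply IsCoprime.pow
    refine (irreducible_X_sub_C α).coprime_iff_not_dvd.mpr ?_
    rwa [dvd_iff_isRoot]
  have hd3 := hcop.dvd_of_dvd_mul_right hd2
  have := degree_le_of_dvd hd3 hw
  rw [degree_pow, degree_X_sub_C] at this
  have h5 := hk w
  simp at this
  exact absurd h5 (not_lt.mpr this)

theorem dbD_count {K : Type*} [Field K] [Fintype K] [DecidableEq K] (p t : ℕ) [ExpChar K p]
    (α : K) (f1 : K[X]) (hf1 : f1.eval α ≠ 0) (D m A L : ℕ) (hLp : L = p ^ t)
    (hQ : Fintype.card K = L ^ 2) (hA : 1 ≤ A) (hL : L = m * A + 1) (hLD : A + D + 2 < L)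
    (hD : ((X - C α) * f1).natDegree ≤ D) (z : K) (hz : z ≠ 0) :
    (Finset.univ.filter (fun x : K => ((X - C α) * f1).eval x ^ (A * (L + 1)) = z)).card
      ≤ A * L + (2 * D + 2) * L := by
  classical
  set f := (X - C α) * f1 with hf
  let I := A + D + 2
  let W := L * A + I + D * L
  let T : Type := (Fin I × Fin m) × Fin A
  let b : T → K[X] := fun s => X ^ (L * s.2.1) * (X - C α) ^ s.1.1.1 * f ^ ((m - s.1.2.1) * A)
    * C (z ^ s.1.2.1)
  have hfdeg : ∀ e, (f ^ e).natDegree ≤ e * D := fun e =>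
    natDegree_pow_le.trans (Nat.mul_le_mul_left _ hD)
  have hb : ∀ s, b s ∈ degreeLT K W := by
    intro s
    rw [mem_degreeLT]
    refine degree_le_natDegree.trans_lt ?_
    have h1 : (b s).natDegree ≤ L * s.2.1 + s.1.1.1 + ((m - s.1.2.1) * A) * D := by
      simp only [b]
      refine (natDegree_mul_C_le _ _).trans ?_
      refine natDegree_mul_le.trans (add_le_add ?_ (hfdeg _))
      refine natDegree_mul_le.trans (add_le_add (natDegree_X_pow_le _) ?_)
      rw [natDegree_pow, natDegree_X_sub_C, mul_one]
    have h2 := s.2.2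
    have h3 := s.1.1.2
    have h4 : (m - s.1.2.1) * A ≤ L := by
      have := Nat.mul_le_mul_right A (Nat.sub_le m s.1.2.1)
      omega
    have h5 : L * s.2.1 ≤ L * A := Nat.mul_le_mul_left _ h2.le
    have h6 : ((m - s.1.2.1) * A) * D ≤ D * L := by
      rw [mul_comm D]; exact Nat.mul_le_mul_right _ h4
    have : (b s).natDegree < W := by simp only [W]; omega
    exact_mod_cast this
  let Φ : (T → K) →ₗ[K] degreeLT K W := Fintype.linearCombination K (fun s => (⟨b s, hb s⟩ : degreeLT K W))
  have hker : LinearMap.ker Φ ≠ ⊥ := by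
    apply LinearMap.ker_ne_bot_of_finrank_lt
    rw [Module.finrank_fintype_fun_eq_card, (degreeLTEquiv K W).finrank_eq,
      Module.finrank_fintype_fun_eq_card]
    simp only [T, Fintype.card_prod, Fintype.card_fin]
    have : I * m * A = I * (L - 1) := by rw [hL, Nat.add_sub_cancel, mul_assoc]
    rw [this]
    obtain ⟨l, rfl⟩ : ∃ l, L = l + 1 := ⟨L - 1, by omega⟩
    simp only [Nat.add_sub_cancel, W, I]
    nlinarith
  obtain ⟨κ, hκ, hκ0⟩ := (Submodule.ne_bot_iff _).mp hker
  have hΦ : ∑ s, κ s • b s = 0 := by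
    have := congrArg (Subtype.val) (LinearMap.mem_ker.mp hκ)
    simpa [Φ, Fintype.linearCombination_apply] using this
  let k : Fin I × Fin m → K[X] := fun u => ∑ a : Fin A, C (κ (u, a) ^ L) * X ^ a.1
  let P : K[X] := ∑ u, k u * (X - C α) ^ (u.1.1 * L) * f ^ (u.2.1 * A)
  have hkdeg : ∀ u, (k u).degree < A := by
    intro u
    simp only [k]
    rw [← mem_degreeLT]
    refine Submodule.sum_mem _ fun a _ => ?_
    rw [mem_degreeLT]
    refine (degree_C_mul_X_pow_le _ _).trans_lt ?_
    exact_mod_cast a.2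
  have hP0 : P ≠ 0 := by
    intro hP
    have h1 := dbD_nonvanish α f1 hf1 I m A L (by omega) k hkdeg hP
    apply hκ0
    funext s
    obtain ⟨u, a⟩ := s
    have h2 : (k u).coeff a.1 = κ (u, a) ^ L := by
      simp only [k, finsetSum_coeff, coeff_C_mul, coeff_X_pow]
      rw [Finset.sum_eq_single a]
      · simp
      · intro c _ hc
        rw [if_neg (fun h => hc (Fin.ext h.symm))]; simp
      · simp
    rw [h1 u, coeff_zero] at h2
    exact pow_eq_zero_iff (by omega) |>.mp h2.symm
  have hPdeg : P.natDegree ≤ A * L + (2 * D + 2) * L := by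
    apply natDegree_sum_le_of_forall_le
    intro u _
    have h1 : (k u).natDegree ≤ A := by
      rw [natDegree_le_iff_degree_le]; exact (hkdeg u).le
    have h2 : (k u * (X - C α) ^ (u.1.1 * L) * f ^ (u.2.1 * A)).natDegree
        ≤ A + u.1.1 * L + u.2.1 * A * D := by
      refine natDegree_mul_le.trans (add_le_add ?_ (hfdeg _))
      refine natDegree_mul_le.trans (add_le_add h1 ?_)
      rw [natDegree_pow, natDegree_X_sub_C, mul_one]
    refine h2.trans ?_
    have h3 : u.1.1 * L ≤ (A + D + 1) * L := Nat.mul_le_mul_right _ (by have := u.1.2; omega)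
    have h4 : u.2.1 * A ≤ m * A := Nat.mul_le_mul_right _ u.2.2.le
    have h5 : u.2.1 * A * D ≤ L * D := Nat.mul_le_mul_right _ (by omega)
    nlinarith
  have hroot : ∀ x : K, f.eval x ^ (A * (L + 1)) = z → P.eval x = 0 := by
    intro x hx
    have hfx : f.eval x ≠ 0 := by
      intro h
      rw [h, zero_pow (by positivity)] at hx
      exact hz hx.symm
    have hcard : ∀ y : K, (y ^ L) ^ L = y := by
      intro y
      rw [← pow_mul, ← sq, ← hQ, FiniteField.pow_card]
    have h1 : f.eval x ^ (m * A) * P.eval x ^ L = 0 := by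
      have h2 : P.eval x = ∑ s : T, κ s ^ L * x ^ s.2.1 * ((x - α) ^ (s.1.1.1)) ^ L
          * f.eval x ^ (s.1.2.1 * A) := by
        simp only [P, k, T, eval_finsetSum, eval_mul, eval_pow, eval_sub, eval_X, eval_C]
        rw [Fintype.sum_prod_type (f := fun s : (Fin I × Fin m) × Fin A =>
          κ s ^ L * x ^ s.2.1 * ((x - α) ^ (s.1.1.1)) ^ L * f.eval x ^ (s.1.2.1 * A))]
        refine Finset.sum_congr rfl fun u _ => ?_
        rw [Finset.sum_mul, Finset.sum_mul]
        refine Finset.sum_congr rfl fun a _ => ?_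
        rw [← pow_mul]
      have h3 : P.eval x ^ L = ∑ s : T, κ s * (x ^ s.2.1) ^ L * (x - α) ^ (s.1.1.1)
          * (f.eval x ^ (s.1.2.1 * A)) ^ L := by
        rw [h2, hLp, sum_pow_char_pow]
        refine Finset.sum_congr rfl fun s _ => ?_
        rw [← hLp, mul_pow, mul_pow, mul_pow, hcard, hcard]
      rw [h3, Finset.mul_sum]
      have h4 := congrArg (eval x) hΦ
      simp only [eval_finsetSum, eval_smul, smul_eq_mul, b, eval_mul, eval_pow, eval_sub, eval_X,
        eval_C, eval_zero] at h4
      rw [← h4]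
      refine Finset.sum_congr rfl fun s _ => ?_
      have h5 : m * A + s.1.2.1 * A * L = (m - s.1.2.1) * A + A * (L + 1) * s.1.2.1 := by
        have h7 := s.1.2.2
        generalize s.1.2.1 = j at h7
        obtain ⟨e, he⟩ : ∃ e, m = j + e := ⟨m - j, by omega⟩
        rw [show m - j = e by omega, he]; ring
      have h6 : f.eval x ^ (m * A) * (f.eval x ^ (s.1.2.1 * A)) ^ L =
          f.eval x ^ ((m - s.1.2.1) * A) * z ^ s.1.2.1 := by
        rw [← hx, ← pow_mul, ← pow_mul, ← pow_add, ← pow_add, h5]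
      calc _ = κ s * (x ^ s.2.1) ^ L * (x - α) ^ (s.1.1.1) *
            (f.eval x ^ (m * A) * (f.eval x ^ (s.1.2.1 * A)) ^ L) := by ring
        _ = _ := by rw [h6]; ring
    rcases mul_eq_zero.mp h1 with h | h
    · exact absurd h (pow_ne_zero _ hfx)
    · exact pow_eq_zero_iff (by omega) |>.mp h
  refine le_trans ?_ hPdeg
  refine le_trans ?_ (card_roots' P)
  refine le_trans (Finset.card_le_card ?_) (Multiset.toFinset_card_le P.roots)
  intro x hx
  simp only [Finset.mem_filter, Finset.mem_univ, true_and] at hx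
  simp [hP0, hroot x hx]

theorem dbE_pow_deg {F K : Type*} [Field F] [Fintype F] [Field K] [Finite K] [Algebra F K] (x : K) :
    x ^ (Fintype.card F ^ (minpoly F x).natDegree) = x := by
  have hfin : FiniteDimensional F K := Module.Finite.of_finite
  have hint : IsIntegral F x := Algebra.IsIntegral.isIntegral x
  have hc : Nat.card (IntermediateField.adjoin F {x}) =
      Fintype.card F ^ (minpoly F x).natDegree := by
    rw [← IntermediateField.adjoin.finrank hint, Module.natCard_eq_pow_finrank (K := F),
      Nat.card_eq_fintype_card]
  have := Fintype.ofFinite (IntermediateField.adjoin F {x})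
  have h := FiniteField.pow_card (IntermediateField.AdjoinSimple.gen F x)
  rw [← Nat.card_eq_fintype_card, hc] at h
  simpa using congrArg (algebraMap _ K) h

theorem dbE_inj {F K : Type*} [Field F] [Fintype F] [Field K] [Finite K] [Algebra F K] (x : K) :
    ∀ i j, i < j → j < (minpoly F x).natDegree →
      x ^ (Fintype.card F ^ i) ≠ x ^ (Fintype.card F ^ j) := by
  intro i j hij hj h
  have hfin : FiniteDimensional F K := Module.Finite.of_finite
  have hint : IsIntegral F x := Algebra.IsIntegral.isIntegral x
  let M := IntermediateField.adjoin F {x}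
  have hM : Module.finrank F M = (minpoly F x).natDegree := IntermediateField.adjoin.finrank hint
  have ho := FiniteField.orderOf_frobeniusAlgHom F M
  rw [hM] at ho
  have hx : ∀ k, ((FiniteField.frobeniusAlgHom F M) ^ k) (IntermediateField.AdjoinSimple.gen F x)
      = (IntermediateField.AdjoinSimple.gen F x) ^ (Fintype.card F ^ k) := by
    intro k
    induction k with
    | zero => simp
    | succ k ih =>
      rw [pow_succ', AlgHom.mul_apply, ih, FiniteField.frobeniusAlgHom_apply, ← pow_mul, ← pow_succ]
  have heq : (FiniteField.frobeniusAlgHom F M) ^ i = (FiniteField.frobeniusAlgHom F M) ^ j := by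
    apply (IntermediateField.adjoin.powerBasis hint).algHom_ext
    rw [IntermediateField.adjoin.powerBasis_gen, hx, hx]
    apply (algebraMap M K).injective
    simpa using h
  have := pow_injOn_Iio_orderOf (x := FiniteField.frobeniusAlgHom F M)
    (by simp only [Set.mem_Iio]; omega) (by simp only [Set.mem_Iio]; omega) heq
  omega

theorem dbE_minpoly {F K : Type*} [Field F] [Fintype F] [Field K] [Finite K] [Algebra F K] (x : K) :
    (minpoly F x).map (algebraMap F K) =
      ∏ i ∈ Finset.range (minpoly F x).natDegree, (X - C (x ^ (Fintype.card F ^ i))) := by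
  have hfin : FiniteDimensional F K := Module.Finite.of_finite
  have hint : IsIntegral F x := Algebra.IsIntegral.isIntegral x
  have hmon := (minpoly.monic hint).map (algebraMap F K)
  refine (eq_of_monic_of_dvd_of_natDegree_le (monic_prod_of_monic _ _ fun i _ => monic_X_sub_C _)
    hmon ?_ ?_)
  · apply Finset.prod_dvd_of_coprime
    · intro i hi j hj hij
      simp only [Finset.coe_range, Set.mem_Iio] at hi hj
      apply isCoprime_X_sub_C_of_isUnit_sub
      rw [isUnit_iff_ne_zero, sub_ne_zero]
      rcases lt_or_gt_of_ne hij with h | h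
      · exact dbE_inj x i j h hj
      · exact (dbE_inj x j i h hi).symm
    · intro i _
      rw [dvd_iff_isRoot, IsRoot, eval_map_algebraMap]
      have := aeval_algHom_apply ((FiniteField.frobeniusAlgHom F K) ^ i) x (minpoly F x)
      rw [minpoly.aeval, map_zero] at this
      have hx : ∀ k, ((FiniteField.frobeniusAlgHom F K) ^ k) x = x ^ (Fintype.card F ^ k) := by
        intro k
        induction k with
        | zero => simp
        | succ k ih =>
          rw [pow_succ', AlgHom.mul_apply, ih, FiniteField.frobeniusAlgHom_apply, ← pow_mul,
            ← pow_succ]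
      rwa [hx] at this
  · rw [natDegree_prod_of_monic _ _ (fun i _ => monic_X_sub_C _), natDegree_map,
      Finset.sum_congr rfl (fun i _ => natDegree_X_sub_C _)]
    simp

theorem dbE_prod_periodic {M : Type*} [CommMonoid M] (g : ℕ → M) (δ k : ℕ)
    (h : ∀ i, g (i + δ) = g i) :
    ∏ i ∈ Finset.range (δ * k), g i = (∏ i ∈ Finset.range δ, g i) ^ k := by
  have h' : ∀ k i, g (δ * k + i) = g i := by
    intro k
    induction k with
    | zero => simp
    | succ k ih => intro i; rw [mul_add, mul_one, add_right_comm, h, ih]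
  induction k with
  | zero => simp
  | succ k ih => rw [mul_add, mul_one, Finset.prod_range_add, ih, pow_succ]; simp [h']

theorem dbE_aeval {F K : Type*} [Field F] [Fintype F] [Field K] [Finite K] [Algebra F K] (x y : K)
    (r : ℕ) (hr : (minpoly F x).natDegree ∣ r) :
    aeval y (minpoly F x ^ (r / (minpoly F x).natDegree)) =
      ∏ i ∈ Finset.range r, (y - x ^ (Fintype.card F ^ i)) := by
  have hfin : FiniteDimensional F K := Module.Finite.of_finite
  have hint : IsIntegral F x := Algebra.IsIntegral.isIntegral x
  obtain ⟨k, rfl⟩ := hr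
  rw [Nat.mul_div_cancel_left _ (minpoly.natDegree_pos hint), map_pow, dbE_prod_periodic]
  · congr 1
    rw [← eval_map_algebraMap, dbE_minpoly, eval_prod]
    simp
  · intro i
    rw [add_comm, pow_add, pow_mul, dbE_pow_deg]

/-- The polynomial `f`, evaluated. -/
theorem dbE_regroup {K : Type*} [Field K] (p e : ℕ) [ExpChar K p] (q n t : ℕ) (hq : q = p ^ e)
    (α x : K) (hα : α ^ (q ^ n) = α) :
    ∏ i ∈ Finset.range (n * t), (α - x ^ (q ^ i)) =
      (∏ a ∈ Finset.range n, (α ^ (q ^ (n - a)) - x) ^ (q ^ a)) ^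
        (∑ b ∈ Finset.range t, (q ^ n) ^ b) := by
  have hpow : ∀ b, α ^ ((q ^ n) ^ b) = α := by
    intro b
    induction b with
    | zero => simp
    | succ b ih => rw [pow_succ, pow_mul, ih, hα]
  induction t with
  | zero => simp
  | succ t ih =>
    rw [mul_add, mul_one, Finset.prod_range_add, ih, Finset.sum_range_succ, pow_add]
    congr 1
    rw [← Finset.prod_pow]
    refine Finset.prod_congr rfl fun a ha => ?_
    simp only [Finset.mem_range] at ha
    rw [← pow_mul, ← pow_mul q, ← pow_add, add_comm a (n * t)]
    have : (α ^ (q ^ (n - a)) - x) ^ (q ^ (n * t + a)) =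
        (α ^ (q ^ (n - a))) ^ (q ^ (n * t + a)) - x ^ (q ^ (n * t + a)) := by
      rw [hq, ← pow_mul p e (n * t + a), sub_pow_expChar_pow]
    rw [this, ← pow_mul, ← pow_add, show n - a + (n * t + a) = n * (t + 1) by
      rw [mul_add, mul_one]; omega, pow_mul q n, hpow]

/-- The monoid homomorphism `f ↦ χ (f α)`. -/
noncomputable def dbPhi {F E : Type*} [Field F] [Field E] [Algebra F E] (χ : MulChar E ℂ) (α : E) :
    F[X] →* ℂ :=
  χ.toMonoidHom.comp (aeval α : F[X] →ₐ[F] E).toMonoidHom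

theorem dbPhi_apply {F E : Type*} [Field F] [Field E] [Algebra F E] (χ : MulChar E ℂ) (α : E)
    (f : F[X]) : dbPhi χ α f = χ (aeval α f) := rfl

theorem dbE_charsum {E K : Type*} [Field E] [Fintype E] [DecidableEq E] [Fintype K]
    (χ : MulChar E ℂ) (hχ : χ ≠ 1) (e : K → E) (B m D : ℕ) (hm : Fintype.card E = m + 1)
    (h0 : (Finset.univ.filter (fun x => e x = 0)).card ≤ D)
    (hz : ∀ z : E, z ≠ 0 → (Finset.univ.filter (fun x => e x = z)).card ≤ B) :
    ‖∑ x, χ (e x)‖ ≤ m * B + D - Fintype.card K := by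
  let N : E → ℕ := fun z => (Finset.univ.filter (fun x => e x = z)).card
  have h1 : ∑ x, χ (e x) = ∑ z, χ z * ((N z : ℂ) - B) := by
    simp_rw [mul_sub]
    rw [Finset.sum_sub_distrib, ← Finset.sum_mul, MulChar.sum_eq_zero_of_ne_one hχ, zero_mul,
      sub_zero]
    rw [← Finset.sum_fiberwise (s := Finset.univ) (g := e)]
    refine Finset.sum_congr rfl fun z _ => ?_
    rw [Finset.sum_congr rfl (g := fun _ => χ z)]
    · simp [N, mul_comm]
    · intro x hx; simp at hx; rw [hx]
  have hcard : ∑ z, N z = Fintype.card K := by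
    simp only [N]
    rw [← Finset.card_eq_sum_card_fiberwise (fun x _ => Finset.mem_univ _), Finset.card_univ]
  rw [h1, ← Finset.add_sum_erase _ _ (Finset.mem_univ (0 : E)), MulChar.map_zero, zero_mul, zero_add]
  rw [← Finset.add_sum_erase _ _ (Finset.mem_univ (0 : E))] at hcard
  calc ‖∑ z ∈ Finset.univ.erase 0, χ z * ((N z : ℂ) - B)‖
      ≤ ∑ z ∈ Finset.univ.erase (0 : E), ((B : ℝ) - N z) := by
        refine norm_sum_le_of_le _ fun z hz' => ?_
        have hz0 : z ≠ 0 := Finset.ne_of_mem_erase hz'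
        have hle : (N z : ℝ) ≤ B := by exact_mod_cast hz z hz0
        have hn1 : ‖χ z‖ ≤ 1 := by
          have hp : χ z ^ (Fintype.card E - 1) = 1 := by
            rw [← map_pow, FiniteField.pow_card_sub_one_eq_one z hz0, map_one]
          have : ‖χ z‖ ^ (Fintype.card E - 1) = 1 := by rw [← norm_pow, hp, norm_one]
          have hc := Fintype.one_lt_card (α := E)
          exact (pow_eq_one_iff_of_nonneg (norm_nonneg _) (by omega)).mp this |>.le
        have hn2 : ‖(N z : ℂ) - B‖ = B - N z := by
          rw [← Complex.ofReal_natCast, ← Complex.ofReal_natCast, ← Complex.ofReal_sub,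
            Complex.norm_real, Real.norm_eq_abs, abs_sub_comm, abs_of_nonneg (by linarith)]
        rw [norm_mul, hn2]
        exact mul_le_of_le_one_left (by linarith) hn1
    _ = m * B - ∑ z ∈ Finset.univ.erase (0 : E), (N z : ℝ) := by
        rw [Finset.sum_sub_distrib, Finset.sum_const, Finset.card_erase_of_mem (Finset.mem_univ _),
          Finset.card_univ, hm]
        simp
    _ ≤ _ := by
        have h2 : ((N 0 : ℕ) : ℝ) + ∑ z ∈ Finset.univ.erase (0 : E), (N z : ℝ) = Fintype.card K := by
          exact_mod_cast hcard
        have h3 : ((N 0 : ℕ) : ℝ) ≤ D := by exact_mod_cast h0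
        linarith

theorem dbE_bound {F E K : Type*} [Field F] [Fintype F] [Field E] [Fintype E] [Field K] [Fintype K]
    [Algebra F E] [Algebra F K] [Algebra E K] [IsScalarTower F E K]
    (q n s D : ℕ) (hcardF : Fintype.card F = q) (hcardE : Fintype.card E = q ^ n)
    (hn : 1 < n) (hD : D = ∑ a ∈ Finset.range n, q ^ a) (hs : 2 * D + 6 ≤ s)
    (hK : Module.finrank E K = 2 * s)
    (α : E) (hα : (minpoly F α).natDegree = n) (χ : MulChar E ℂ) (hχ : χ ≠ 1) :
    ‖∑ x : K, dbPhi χ α (minpoly F x ^ (2 * n * s / (minpoly F x).natDegree))‖ ≤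
      (((q ^ n - 1) * (2 * D + 2) + D : ℕ) : ℝ) * q ^ (n * s) := by
  classical
  have hfinK : FiniteDimensional F K := Module.Finite.of_finite
  have hfinE : FiniteDimensional F E := Module.Finite.of_finite
  have hfinEK : FiniteDimensional E K := Module.Finite.of_finite
  have hq2 : 2 ≤ q := by rw [← hcardF]; exact Fintype.one_lt_card
  obtain ⟨p, hchar, e, hp, hqp⟩ := FiniteField.card' (K := F)
  have hpf : Fact p.Prime := ⟨hp⟩
  have hcharK : CharP K p := charP_of_injective_algebraMap (algebraMap F K).injective p
  have hexp : ExpChar K p := ExpChar.prime hp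
  have hqpe : q = p ^ (e : ℕ) := by rw [← hcardF, hqp]
  set Q := q ^ n with hQdef
  have hQ4 : 4 ≤ Q := by
    calc 4 = 2 ^ 2 := by norm_num
      _ ≤ 2 ^ n := Nat.pow_le_pow_right (by norm_num) hn
      _ ≤ q ^ n := Nat.pow_le_pow_left hq2 n
  set m := Q - 1 with hm
  have hQm : Q = m + 1 := by omega
  set A := ∑ b ∈ Finset.range s, Q ^ b with hAdef
  set L := Q ^ s with hLdef
  have hL : L = m * A + 1 := by
    have hg : (∑ b ∈ Finset.range s, (m + 1) ^ b) * m + 1 = (m + 1) ^ s := by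
      have := geom_sum_mul_add m s
      exact this
    rw [← hQm] at hg
    rw [hLdef, ← hg, mul_comm]
  have hA2 : A * (L + 1) = ∑ b ∈ Finset.range (2 * s), Q ^ b := by
    rw [two_mul, Finset.sum_range_add, mul_add, mul_one, add_comm]
    congr 1
    rw [hAdef, Finset.sum_mul]
    refine Finset.sum_congr rfl fun b _ => ?_
    rw [pow_add, mul_comm]
  have hAs : s ≤ A := by
    calc s = ∑ b ∈ Finset.range s, 1 := by simp
      _ ≤ A := Finset.sum_le_sum fun b _ => Nat.one_le_pow _ _ (by omega)
  have hcardK : Fintype.card K = L ^ 2 := by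
    rw [Module.card_eq_pow_finrank (K := E), hcardE, hK, hLdef, mul_comm, pow_mul]
  have hFE : Module.finrank F E = n := by
    have h := Module.card_eq_pow_finrank (K := F) (V := E)
    rw [hcardE, hcardF] at h
    exact (Nat.pow_right_injective hq2 h).symm
  have hFK : Module.finrank F K = n * (2 * s) := by
    rw [← Module.finrank_mul_finrank F E K, hFE, hK]
  have hLp : L = p ^ (e * n * s) := by
    rw [hLdef, hQdef, hqpe, ← pow_mul, ← pow_mul, mul_assoc]
  set α' := algebraMap E K α with hα'
  have hαQ : α' ^ Q = α' := by
    rw [hα', ← map_pow, ← hcardE, FiniteField.pow_card]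
  set f2 : K[X] := ∏ a ∈ Finset.range (n - 1), (C (α' ^ (q ^ (n - (a + 1)))) - X) ^ (q ^ (a + 1))
    with hf2
  set f : K[X] := (X - C α') * (- f2) with hf
  have hfprod : f = ∏ a ∈ Finset.range n, (C (α' ^ (q ^ (n - a))) - X) ^ (q ^ a) := by
    obtain ⟨k, rfl⟩ : ∃ k, n = k + 1 := ⟨n - 1, by omega⟩
    rw [Finset.prod_range_succ', hf, hf2]
    simp only [Nat.add_sub_cancel, pow_zero, pow_one, Nat.sub_zero]
    rw [← hQdef, hαQ]
    ring
  have hf1 : (- f2).eval α' ≠ 0 := by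
    rw [eval_neg, neg_ne_zero, hf2, eval_prod, Finset.prod_ne_zero_iff]
    intro a ha
    have han := Finset.mem_range.mp ha
    rw [eval_pow, eval_sub, eval_C, eval_X]
    refine pow_ne_zero _ (sub_ne_zero.mpr ?_)
    intro h
    have := dbE_inj (F := F) α 0 (n - (a + 1)) (by omega) (by omega)
    apply this
    apply (algebraMap E K).injective
    rw [map_pow, map_pow, pow_zero, pow_one, hcardF, h]
  have hfdeg : f.natDegree ≤ D := by
    rw [hfprod, hD]
    refine (natDegree_prod_le _ _).trans (Finset.sum_le_sum fun a _ => ?_)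
    refine natDegree_pow_le.trans ?_
    have : (C (α' ^ (q ^ (n - a))) - X : K[X]).natDegree ≤ 1 :=
      (natDegree_sub_le _ _).trans (by simp)
    calc _ ≤ q ^ a * 1 := Nat.mul_le_mul_left _ this
      _ = _ := mul_one _
  have hf0 : f ≠ 0 := by
    rw [hf]
    refine mul_ne_zero (X_sub_C_ne_zero _) ?_
    intro h
    rw [h] at hf1
    simp at hf1
  let ev : K → E := fun x => aeval α (minpoly F x ^ (2 * n * s / (minpoly F x).natDegree))
  have hev : ∀ x, algebraMap E K (ev x) = f.eval x ^ (A * (L + 1)) := by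
    intro x
    have hdvd : (minpoly F x).natDegree ∣ n * (2 * s) := by
      rw [← hFK]
      exact minpoly.degree_dvd (Algebra.IsIntegral.isIntegral x)
    have hr : 2 * n * s = n * (2 * s) := by ring
    simp only [ev]
    rw [hr, ← aeval_algebraMap_apply, dbE_aeval x _ _ hdvd, hcardF,
      dbE_regroup p e q n (2 * s) hqpe _ _ hαQ, hfprod, eval_prod, hA2]
    congr 1
    refine Finset.prod_congr rfl fun a _ => ?_
    rw [eval_pow, eval_sub, eval_C, eval_X]
  have hB := fun z hz => dbD_count p (e * n * s) α' (- f2) hf1 D m A L hLp hcardK (by omega) hL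
    (by nlinarith) hfdeg z hz
  have hmain := dbE_charsum χ hχ ev (A * L + (2 * D + 2) * L) m D (by rw [hcardE, hQm]) ?_ ?_
  · refine hmain.trans ?_
    rw [hcardK]
    have hLr : (L : ℝ) = m * A + 1 := by exact_mod_cast hL
    have hqL : (q : ℝ) ^ (n * s) = L := by rw [pow_mul, hLdef, hQdef]; push_cast; rfl
    have hL1 : (1 : ℝ) ≤ L := by
      have : (0 : ℝ) ≤ m * A := mul_nonneg (Nat.cast_nonneg m) (Nat.cast_nonneg A)
      linarith
    have hD0 : (0 : ℝ) ≤ D := Nat.cast_nonneg D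
    rw [hqL]
    push_cast
    have : (m : ℝ) * (A * L + (2 * D + 2) * L) = (m * A) * L + m * (2 * D + 2) * L := by ring
    rw [this]
    have h3 : (m : ℝ) * A = L - 1 := by linarith
    rw [h3]
    nlinarith
  · calc _ ≤ f.roots.toFinset.card := by
          refine Finset.card_le_card fun x hx => ?_
          rw [Finset.mem_filter] at hx
          rw [Multiset.mem_toFinset, mem_roots hf0, IsRoot.def]
          have := hev x
          rw [hx.2, map_zero] at this
          exact eq_zero_of_pow_eq_zero this.symm
      _ ≤ Multiset.card f.roots := Multiset.toFinset_card_le _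
      _ ≤ _ := (card_roots' f).trans hfdeg
  · intro z hz
    refine le_trans (Finset.card_le_card fun x hx => ?_) (hB (algebraMap E K z) ((_root_.map_ne_zero _).mpr hz))
    rw [Finset.mem_filter] at hx ⊢
    refine ⟨Finset.mem_univ _, ?_⟩
    rw [← hev x, hx.2]

theorem dbF_c_zero {F : Type*} [Field F] [Finite F] (φ : F[X] →* ℂ) : dbC φ 0 = 1 := by
  have : dbMon F 0 = {1} := by
    ext f
    rw [mem_dbMon, Finset.mem_singleton]
    constructor
    · rintro ⟨h1, h2⟩
      exact (Polynomial.Monic.natDegree_eq_zero h1).mp h2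
    · rintro rfl
      exact ⟨monic_one, natDegree_one⟩
  rw [dbC, this, Finset.sum_singleton, map_one]

theorem dbF_surj {F E : Type*} [Field F] [Fintype F] [Field E] [Fintype E]
    [Algebra F E] (n : ℕ) (hFE : Module.finrank F E = n)
    (α : E) (hα : (minpoly F α).natDegree = n) (y : E) :
    ∃ u : F[X], u.degree < n ∧ aeval α u = y := by
  have hfinE : FiniteDimensional F E := Module.Finite.of_finite
  have hint : IsIntegral F α := Algebra.IsIntegral.isIntegral α
  have htop : IntermediateField.adjoin F {α} = ⊤ := by
    rw [Field.primitive_element_iff_minpoly_natDegree_eq, hα, hFE]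
  have hy : y ∈ IntermediateField.adjoin F {α} := by rw [htop]; trivial
  rw [← IntermediateField.mem_toSubalgebra,
    IntermediateField.adjoin_simple_toSubalgebra_of_isAlgebraic hint.isAlgebraic,
    Algebra.adjoin_singleton_eq_range_aeval] at hy
  obtain ⟨v, hv⟩ := hy
  refine ⟨v %ₘ minpoly F α, ?_, ?_⟩
  · refine (degree_modByMonic_lt _ (minpoly.monic hint)).trans_eq ?_
    rw [degree_eq_natDegree (minpoly.ne_zero hint), hα]
  · rw [← hv]
    exact aeval_modByMonic_eq_self_of_root (minpoly.aeval F α)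

theorem dbF_c_high {F E : Type*} [Field F] [Fintype F] [Field E] [Fintype E]
    [Algebra F E] (n : ℕ) (hFE : Module.finrank F E = n)
    (α : E) (hα : (minpoly F α).natDegree = n) (χ : MulChar E ℂ) (hχ : χ ≠ 1) (r : ℕ) (hr : n ≤ r) :
    dbC (dbPhi (F := F) χ α) r = 0 := by
  classical
  choose u hu1 hu2 using dbF_surj n hFE α hα
  let N : E → ℕ := fun z => ((dbMon F r).filter (fun f => aeval α f = z)).card
  have hadd : ∀ z : E, ∀ f ∈ dbMon F r, f + u z ∈ dbMon F r := by
    intro z f hf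
    rw [mem_dbMon] at hf ⊢
    have hdeg : (u z).degree < f.degree := by
      refine (hu1 z).trans_le ?_
      rw [degree_eq_natDegree hf.1.ne_zero, hf.2]
      exact_mod_cast hr
    refine ⟨hf.1.add_of_left hdeg, ?_⟩
    rw [natDegree_add_eq_left_of_degree_lt hdeg, hf.2]
  have hle : ∀ z w, N z ≤ N w := by
    intro z w
    refine Finset.card_le_card_of_injOn (fun f => f + u (w - z)) ?_ (fun a _ b _ h => add_right_cancel h)
    intro f hf
    simp only [Finset.coe_filter, Set.mem_ofPred_eq] at hf ⊢
    refine ⟨hadd _ _ hf.1, ?_⟩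
    rw [map_add, hf.2, hu2]; ring
  have hN : ∀ z, N z = N 0 := fun z => le_antisymm (hle _ _) (hle _ _)
  rw [dbC, ← Finset.sum_fiberwise (s := dbMon F r) (g := fun f => aeval α f)]
  have : ∀ z ∈ (Finset.univ : Finset E),
      ∑ f ∈ (dbMon F r).filter (fun f => aeval α f = z), dbPhi χ α f = χ z * (N 0 : ℂ) := by
    intro z _
    rw [← hN z, Finset.sum_congr rfl (g := fun _ => χ z)]
    · simp [N, mul_comm]
    · intro x hx
      rw [dbPhi_apply, (Finset.mem_filter.mp hx).2]
  rw [Finset.sum_congr rfl this, ← Finset.sum_mul, MulChar.sum_eq_zero_of_ne_one hχ, zero_mul]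

theorem dbF_weil {F E : Type*} [Field F] [Fintype F] [Field E] [Fintype E]
    [Algebra F E] (q n : ℕ) (hcardF : Fintype.card F = q) (hcardE : Fintype.card E = q ^ n)
    (hn : 1 < n) (α : E) (hα : (minpoly F α).natDegree = n) (χ : MulChar E ℂ) (hχ : χ ≠ 1)
    (d : ℕ) (hd : 1 ≤ d) :
    ‖dbPsi (dbPhi (F := F) χ α) d‖ ≤ ((n - 1 : ℕ) : ℝ) * (Real.sqrt q) ^ d := by
  have hfinE : FiniteDimensional F E := Module.Finite.of_finite
  have hq2 : 2 ≤ q := by rw [← hcardF]; exact Fintype.one_lt_card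
  have hFE : Module.finrank F E = n := by
    have h := Module.card_eq_pow_finrank (K := F) (V := E)
    rw [hcardE, hcardF] at h
    exact (Nat.pow_right_injective hq2 h).symm
  obtain ⟨p, hchar, e, hp, hqp⟩ := FiniteField.card' (K := E)
  have hpf : Fact p.Prime := ⟨hp⟩
  set D := ∑ a ∈ Finset.range n, q ^ a with hD
  refine dbA_final (n - 1) (dbC (dbPhi (F := F) χ α)) (dbPsi (dbPhi (F := F) χ α)) (dbF_c_zero _)
    (fun r hr => dbF_c_high n hFE α hα χ hχ r (by omega)) (fun r _ => dbB_newton _ r)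
    (Real.sqrt q) (((q ^ n - 1) * (2 * D + 2) + D : ℕ) : ℝ)
    (Real.sqrt_pos.mpr (by positivity)) (2 * n) (2 * D + 6) (by omega) ?_ d hd
  intro s hs
  have : NeZero (2 * s) := ⟨by omega⟩
  let K := FiniteField.Extension E p (2 * s)
  let _ : Algebra F K := ((algebraMap E K).comp (algebraMap F E)).toAlgebra
  have : IsScalarTower F E K := IsScalarTower.of_algebraMap_eq fun _ => rfl
  have : Finite K := Module.finite_of_finite E
  let _ : Fintype K := Fintype.ofFinite K
  have hK : Module.finrank E K = 2 * s := FiniteField.finrank_extension E p (2 * s)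
  have hFK : Module.finrank F K = 2 * n * s := by
    rw [← Module.finrank_mul_finrank F E K, hFE, hK]; ring
  rw [dbB_psi_eq _ (2 * n * s) (by
    have : 1 ≤ n * s := Nat.mul_pos (by omega) (by omega)
    nlinarith) K hFK]
  refine (dbE_bound q n s D hcardF hcardE hn hD hs hK α hα χ hχ).trans (le_of_eq ?_)
  congr 1
  rw [mul_assoc, pow_mul (Real.sqrt q), Real.sq_sqrt (by positivity)]

theorem dbG_orth {E : Type*} [Field E] [Fintype E] [Fintype (MulChar E ℂ)] (a : E) (ha : a ≠ 1) :
    ∑ χ : MulChar E ℂ, χ a = 0 := by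
  obtain ⟨χ, hχ⟩ := MulChar.exists_apply_ne_one_of_hasEnoughRootsOfUnity E ℂ ha
  have h : χ a * ∑ ψ : MulChar E ℂ, ψ a = ∑ ψ : MulChar E ℂ, ψ a := by
    rw [Finset.mul_sum]
    simp_rw [← MulChar.mul_apply]
    exact Fintype.sum_bijective _ (Group.mulLeft_bijective χ) _ _ fun _ => rfl
  have h2 : (χ a - 1) * ∑ ψ : MulChar E ℂ, ψ a = 0 := by rw [sub_mul, h]; ring
  exact (mul_eq_zero.mp h2).resolve_left (sub_ne_zero.mpr hχ)

theorem dbG_count {E K : Type*} [Field E] [Fintype E] [Fintype K] (c : K → E) (hc : ∀ x, c x ≠ 0)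
    (M : ℝ) (hM : 0 ≤ M) (hS : ∀ χ : MulChar E ℂ, χ ≠ 1 → ‖∑ x, χ (c x)‖ ≤ M) (k : ℕ)
    (hk : (Fintype.card E : ℝ) * M ^ k < (Fintype.card K : ℝ) ^ k) (β : Eˣ) :
    ∃ x : Fin k → K, (β : E) = ∏ i, c (x i) := by
  classical
  have : Finite (MulChar E ℂ) := inferInstance
  let _ : Fintype (MulChar E ℂ) := Fintype.ofFinite _
  by_contra! hcon
  have h1 : ∑ χ : MulChar E ℂ, χ ((β⁻¹ : Eˣ) : E) * (∑ x, χ (c x)) ^ k = 0 := by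
    have : ∀ χ : MulChar E ℂ, χ ((β⁻¹ : Eˣ) : E) * (∑ x, χ (c x)) ^ k =
        ∑ y : Fin k → K, χ (((β⁻¹ : Eˣ) : E) * ∏ i, c (y i)) := by
      intro χ
      rw [Fintype.sum_pow, Finset.mul_sum]
      refine Finset.sum_congr rfl fun y _ => ?_
      rw [map_mul, map_prod]
    simp_rw [this]
    rw [Finset.sum_comm]
    refine Finset.sum_eq_zero fun y _ => dbG_orth _ ?_
    intro h
    apply hcon y
    rw [← one_mul (∏ i, c (y i)), ← Units.mul_inv β, mul_assoc, h, mul_one]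
  rw [← Finset.add_sum_erase _ _ (Finset.mem_univ (1 : MulChar E ℂ))] at h1
  have h2 : ∑ x, (1 : MulChar E ℂ) (c x) = Fintype.card K := by
    rw [Finset.sum_congr rfl (g := fun _ => (1 : ℂ))]
    · simp
    · intro x _
      exact MulChar.one_apply (isUnit_iff_ne_zero.mpr (hc x))
  have hunit : ∀ (χ : MulChar E ℂ), ‖χ ((β⁻¹ : Eˣ) : E)‖ = 1 := by
    intro χ
    have hp : χ ((β⁻¹ : Eˣ) : E) ^ (Fintype.card E - 1) = 1 := by
      rw [← map_pow, FiniteField.pow_card_sub_one_eq_one _ (Units.ne_zero _), map_one]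
    have : ‖χ ((β⁻¹ : Eˣ) : E)‖ ^ (Fintype.card E - 1) = 1 := by rw [← norm_pow, hp, norm_one]
    have hc := Fintype.one_lt_card (α := E)
    exact (pow_eq_one_iff_of_nonneg (norm_nonneg _) (by omega)).mp this
  rw [h2, MulChar.one_apply (Units.isUnit _), one_mul] at h1
  have h3 : (Fintype.card K : ℝ) ^ k ≤ (Fintype.card E : ℝ) * M ^ k := by
    calc (Fintype.card K : ℝ) ^ k = ‖(Fintype.card K : ℂ) ^ k‖ := by simp
      _ = ‖∑ χ ∈ Finset.univ.erase (1 : MulChar E ℂ),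
            χ ((β⁻¹ : Eˣ) : E) * (∑ x, χ (c x)) ^ k‖ := by
          rw [eq_neg_of_add_eq_zero_left h1, norm_neg]
      _ ≤ ∑ χ ∈ Finset.univ.erase (1 : MulChar E ℂ), M ^ k := by
          refine norm_sum_le_of_le _ fun χ hχ => ?_
          rw [norm_mul, hunit, one_mul, norm_pow]
          exact pow_le_pow_left₀ (norm_nonneg _) (hS χ (Finset.ne_of_mem_erase hχ)) k
      _ ≤ ∑ χ : MulChar E ℂ, M ^ k :=
          Finset.sum_le_sum_of_subset_of_nonneg (Finset.erase_subset _ _)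
            fun _ _ _ => pow_nonneg hM k
      _ = (Fintype.card (MulChar E ℂ) : ℝ) * M ^ k := by simp
      _ ≤ _ := by
          have hle : Fintype.card (MulChar E ℂ) ≤ Fintype.card E := by
            rw [← Nat.card_eq_fintype_card, MulChar.card_eq_card_units_of_hasEnoughRootsOfUnity,
              ← Nat.card_eq_fintype_card]
            exact Nat.card_le_card_of_injective _ Units.val_injective
          gcongr
  linarith

theorem dbG_real (q n d : ℕ) (hq : 2 ≤ q) (hn : 1 < n) (hd : 1 ≤ d)
    (hcond : (n : ℝ) < (q : ℝ) ^ ((d : ℝ) / 2) + 1) :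
    ∃ k : ℕ, 1 ≤ k ∧
      (k : ℝ) ≤ 2 * (n : ℝ) / d + 1 +
        (4 * ((n : ℝ) / d) * Real.log ((n : ℝ) - 1)) /
          ((d : ℝ) * Real.log q - 2 * Real.log ((n : ℝ) - 1)) ∧
      ((q ^ n : ℕ) : ℝ) * (((n - 1 : ℕ) : ℝ) * (Real.sqrt q) ^ d) ^ k < ((q ^ d : ℕ) : ℝ) ^ k := by
  have hq0 : (0 : ℝ) < q := by positivity
  have hq1 : (1 : ℝ) < q := by exact_mod_cast hq
  have hn1 : (2 : ℝ) ≤ n := by exact_mod_cast hn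
  have hd1 : (1 : ℝ) ≤ d := by exact_mod_cast hd
  rw [Nat.cast_sub hn.le, Nat.cast_one]
  set b : ℝ := (n : ℝ) - 1 with hb
  have hb1 : 1 ≤ b := by linarith
  set u : ℝ := (Real.sqrt q) ^ d with hu
  have hlq : 0 < Real.log q := Real.log_pos hq1
  have hlogu : Real.log u = d * (Real.log q / 2) := by
    rw [hu, Real.log_pow, Real.log_sqrt hq0.le]
  have hu0 : 0 < u := pow_pos (Real.sqrt_pos.mpr hq0) d
  have huu : u = (q : ℝ) ^ ((d : ℝ) / 2) := by
    rw [hu, Real.sqrt_eq_rpow, ← Real.rpow_natCast, ← Real.rpow_mul hq0.le]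
    congr 1; ring
  have hbu : b < u := by rw [huu]; linarith
  have hlog : Real.log b < Real.log u := Real.log_lt_log (by linarith) hbu
  have hlb : 0 ≤ Real.log b := Real.log_nonneg hb1
  set Δ : ℝ := (d : ℝ) * Real.log q - 2 * Real.log b with hΔ
  have hΔ0 : 0 < Δ := by rw [hlogu] at hlog; linarith
  set x : ℝ := 2 * n * Real.log q / Δ with hx
  have hx0 : 0 ≤ x := by positivity
  have hxe : 2 * (n : ℝ) / d + (4 * ((n : ℝ) / d) * Real.log b) / Δ = x := by
    have hd0 : (d : ℝ) ≠ 0 := by positivity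
    rw [hx, eq_div_iff hΔ0.ne', add_mul, div_mul_cancel₀ _ hΔ0.ne', hΔ]
    field_simp
    ring
  refine ⟨⌊x⌋₊ + 1, by omega, ?_, ?_⟩
  · push_cast
    have := Nat.floor_le hx0
    linarith
  · set k := ⌊x⌋₊ + 1 with hk
    have hkx : x < k := by rw [hk]; push_cast; exact Nat.lt_floor_add_one x
    have hb0 : 0 < b := by linarith
    have hquu : ((q ^ d : ℕ) : ℝ) = u * u := by
      rw [hu, ← mul_pow, Real.mul_self_sqrt hq0.le]; push_cast; rfl
    rw [hquu, mul_pow, mul_pow, ← mul_assoc]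
    refine mul_lt_mul_of_pos_right ?_ (pow_pos hu0 k)
    push_cast
    rw [← Real.log_lt_log_iff (by positivity) (by positivity),
      Real.log_mul (by positivity) (by positivity), Real.log_pow, Real.log_pow, Real.log_pow, hlogu]
    rw [hx, div_lt_iff₀ hΔ0, hΔ] at hkx
    linarith

/-- Diameter bound: if `n < q^{d/2}+1`, every `β ∈ 𝔽_{q^n}^×` is a product of `k` elements
of `E_d` for some positive `k ≤ 2(n/d) + 1 + 4(n/d)log(n-1)/(d log q - 2 log(n-1))`. -/
theorem diameter_bound
    {F E : Type*} [Field F] [Fintype F] [Field E] [Fintype E] [Algebra F E]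
    (q n d : ℕ) (hq : IsPrimePow q)
    (hcardF : Fintype.card F = q) (hcardE : Fintype.card E = q ^ n)
    (hn : 1 < n) (hd : 1 ≤ d) (hdn : d < n)
    (hcond : (n : ℝ) < (q : ℝ) ^ ((d : ℝ) / 2) + 1)
    (α : E) (hα : (minpoly F α).natDegree = n) :
    ∀ β : Eˣ, ∃ k : ℕ, 1 ≤ k ∧
      (k : ℝ) ≤ 2 * (n : ℝ) / d + 1 +
        (4 * ((n : ℝ) / d) * Real.log ((n : ℝ) - 1)) /
          ((d : ℝ) * Real.log q - 2 * Real.log ((n : ℝ) - 1)) ∧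
      ∃ g : Fin k → Polynomial F, (∀ i, g i ∈ primarySet F d) ∧
        (β : E) = ∏ i, Polynomial.aeval α (g i) := by
  intro β
  have hq2 : 2 ≤ q := hq.two_le
  obtain ⟨k, hk1, hk2, hk3⟩ := dbG_real q n d hq2 hn hd hcond
  refine ⟨k, hk1, hk2, ?_⟩
  obtain ⟨p, hchar, e, hp, hqp⟩ := FiniteField.card' (K := F)
  have hpf : Fact p.Prime := ⟨hp⟩
  have : NeZero d := ⟨by omega⟩
  let K := FiniteField.Extension F p d
  have : Finite K := Module.finite_of_finite F
  let _ : Fintype K := Fintype.ofFinite K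
  have hFK : Module.finrank F K = d := FiniteField.finrank_extension F p d
  have hcardK : Fintype.card K = q ^ d := by
    rw [Module.card_eq_pow_finrank (K := F), hcardF, hFK]
  have hint : ∀ x : K, IsIntegral F x := fun x => Algebra.IsIntegral.isIntegral x
  have hdvd : ∀ x : K, (minpoly F x).natDegree ∣ d := fun x => by
    exact (minpoly.degree_dvd (hint x)).trans (dvd_of_eq hFK)
  let G : K → F[X] := fun x => minpoly F x ^ (d / (minpoly F x).natDegree)
  have hG : ∀ x, G x ∈ primarySet F d := by
    intro x
    refine ⟨(minpoly.monic (hint x)).pow _, ?_, minpoly F x, minpoly.monic (hint x),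
      minpoly.irreducible (hint x), _, ?_, rfl⟩
    · simp only [G]
      rw [natDegree_pow, Nat.div_mul_cancel (hdvd x)]
    · exact Nat.div_pos (Nat.le_of_dvd (by omega) (hdvd x)) (minpoly.natDegree_pos (hint x))
  have hG0 : ∀ x, aeval α (G x) ≠ 0 := by
    intro x
    simp only [G, map_pow]
    refine pow_ne_zero _ fun h => ?_
    have h1 := natDegree_le_of_dvd (minpoly.dvd F α h) (minpoly.ne_zero (hint x))
    have h2 := Nat.le_of_dvd (by omega) (hdvd x)
    omega
  obtain ⟨x, hx⟩ := dbG_count (fun x : K => aeval α (G x)) hG0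
    (((n - 1 : ℕ) : ℝ) * (Real.sqrt q) ^ d) (by positivity) (fun χ hχ => by
      have := dbF_weil q n hcardF hcardE hn α hα χ hχ d hd
      rw [dbB_psi_eq _ d hd K hFK] at this
      exact this) k (by rw [hcardE, hcardK]; exact hk3) β
  exact ⟨fun i => G (x i), fun i => hG _, hx⟩
end
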